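/- Let n, ℓ ∈ ℕ, let P be a hereditary property of ordered graphs, and suppose that |P_n| < F_{n,ℓ+1}. Then there exist k, k' ∈ ℕ such that every ordered graph G ∈ P can be written as G = H △ J, where H is an ordered graph on the same vertex set with at most k homogeneous blocks, J is an ordered graph on the same vertex set belonging to 𝒥(k',ℓ), and △ denotes the symmetric difference of the edge sets. -/

import Mathlib

open Finset

/-- `IndSub G H` : `G` is an induced ordered subgraph of `H`, i.e. there is an
order-preserving injection of the vertices preserving adjacency and non-adjacency. -/
def IndSub {m n : ℕ} (G : SimpleGraph (Fin m)) (H : SimpleGraph (Fin n)) : Prop :=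
  ∃ φ : Fin m ↪o Fin n, ∀ i j : Fin m, G.Adj i j ↔ H.Adj (φ i) (φ j)

/-- A hereditary property of ordered graphs: a family of ordered graphs (one set of
graphs on `[n]` for each `n`), closed under taking induced ordered subgraphs.  (Closure
under order-preserving isomorphisms is automatic in this encoding, since the only
order-preserving bijection of `Fin n` is the identity.) -/
structure HerProp where
  mem : ∀ n : ℕ, Set (SimpleGraph (Fin n))
  hered : ∀ {m n : ℕ} (G : SimpleGraph (Fin m)) (H : SimpleGraph (Fin n)),
    IndSub G H → H ∈ mem n → G ∈ mem m

/-- The speed of a property: `n ↦ |P_n|`. -/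
noncomputable def speed (P : HerProp) (n : ℕ) : ℕ := (P.mem n).ncard

/-- Generalized Fibonacci numbers `F_{n,k}` of order `k`:
`F_{0,k} = 1`, `F_{n,k} = F_{n-1,k} + ⋯ + F_{n-k,k}` (terms with negative index are 0). -/
def genFib (k : ℕ) : ℕ → ℕ
  | 0 => 1
  | n + 1 => ∑ i ∈ Finset.range k, if i ≤ n then genFib k (n - i) else 0
decreasing_by omega

/-- `lHom G ℓ x y` : vertices `x` and `y` are `ℓ`-homogeneous in `G`
(`x ∼_ℓ y`), i.e. they have the same neighbourhoods outside `N_ℓ(x) ∪ N_ℓ(y)`. -/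
def lHom {N : ℕ} (G : SimpleGraph (Fin N)) (ℓ : ℕ) (x y : Fin N) : Prop :=
  ∀ v : Fin N, ℓ ≤ ((v : ℤ) - (x : ℤ)).natAbs → ℓ ≤ ((v : ℤ) - (y : ℤ)).natAbs →
    (G.Adj x v ↔ G.Adj y v)

/-- `G` contains a `k`-structure of Type 1. -/
def HasType1 {N : ℕ} (G : SimpleGraph (Fin N)) (k : ℕ) : Prop :=
  ∃ (y : Fin N) (x : Fin (2 * k) → Fin N), StrictMono x ∧
    ((∀ i, y < x i) ∨ (∀ i, x i < y)) ∧
    ∀ i j : Fin (2 * k), (j : ℕ) = (i : ℕ) + 1 → (G.Adj y (x i) ↔ ¬ G.Adj y (x j))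

/-- `G` contains a `k`-structure of Type 2 (2(a) or 2(b)). -/
def HasType2 {N : ℕ} (G : SimpleGraph (Fin N)) (k : ℕ) : Prop :=
  ∃ x y : Fin (2 * k) → Fin N, StrictMono x ∧ (StrictMono y ∨ StrictAnti y) ∧
    (∀ i j, x i < y j) ∧
    ∀ i j : Fin (2 * k), (j : ℕ) = (i : ℕ) + 1 → (G.Adj (x i) (y i) ↔ ¬ G.Adj (x j) (y j))

/-- `G` contains a `(k,ℓ)`-structure of Type 3. -/
def HasType3 {N : ℕ} (G : SimpleGraph (Fin N)) (k ℓ : ℕ) : Prop :=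
  ∃ (x y : Fin (2 * k) → Fin N) (z : Fin (2 * k) → Fin (ℓ - 1) → Fin N),
    (∀ i t, x i < z i t) ∧ (∀ i, StrictMono (z i)) ∧ (∀ i t, z i t < y i) ∧
    (∀ i, x i < y i) ∧
    (∀ i j : Fin (2 * k), (j : ℕ) = (i : ℕ) + 1 → y i < x j) ∧
    ∀ i j : Fin (2 * k), (j : ℕ) = (i : ℕ) + 1 → (G.Adj (x i) (y i) ↔ ¬ G.Adj (x j) (y j))

/-- `S_n(G)` : the number of pairwise non-isomorphic (as ordered graphs) induced ordered
subgraphs of `G` of order `n`. -/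
noncomputable def numSub {N : ℕ} (G : SimpleGraph (Fin N)) (n : ℕ) : ℕ :=
  {H : SimpleGraph (Fin n) | IndSub H G}.ncard
/-- The ordered graph `M^<_I(X,Y)` with `|X| = |Y| = m` (vertices `0,…,m-1` playing the
role of `x_1 < … < x_m` and vertices `m,…,2m-1` the role of `y_1 < … < y_m`). -/
def Mlt (m : ℕ) (I1 I2 I3 I4 : Bool) : SimpleGraph (Fin (2 * m)) :=
  SimpleGraph.fromRel (fun u v =>
    ((u : ℕ) < m ∧ (v : ℕ) < m ∧ I1 = true) ∨
    (m ≤ (u : ℕ) ∧ m ≤ (v : ℕ) ∧ I4 = true) ∨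
    ((u : ℕ) < m ∧ m ≤ (v : ℕ) ∧
      (((u : ℕ) < (v : ℕ) - m ∧ I2 = true) ∨
       ((v : ℕ) - m < (u : ℕ) ∧ I3 = true) ∨
       ((u : ℕ) = (v : ℕ) - m ∧ Even (u : ℕ)))))

/-- The ordered graph `M^>_I(X,Y)`: as `M^<_I(X,Y)` but with the `y`-indices reversed,
i.e. vertex `m + p` plays the role of `y_{m-p}` (so that `y_1 > y_2 > … > y_m`). -/
def Mgt (m : ℕ) (I1 I2 I3 I4 : Bool) : SimpleGraph (Fin (2 * m)) :=
  SimpleGraph.fromRel (fun u v =>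
    ((u : ℕ) < m ∧ (v : ℕ) < m ∧ I1 = true) ∨
    (m ≤ (u : ℕ) ∧ m ≤ (v : ℕ) ∧ I4 = true) ∨
    ((u : ℕ) < m ∧ m ≤ (v : ℕ) ∧
      (((u : ℕ) < 2 * m - 1 - (v : ℕ) ∧ I2 = true) ∨
       (2 * m - 1 - (v : ℕ) < (u : ℕ) ∧ I3 = true) ∨
       ((u : ℕ) = 2 * m - 1 - (v : ℕ) ∧ Even (u : ℕ)))))

/-- `B` is a set of consecutive vertices which is pairwise 1-homogeneous. -/
def IsHomInterval {N : ℕ} (G : SimpleGraph (Fin N)) (B : Set (Fin N)) : Prop :=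
  (∀ x y z : Fin N, x ∈ B → z ∈ B → x ≤ y → y ≤ z → y ∈ B) ∧
  (∀ x ∈ B, ∀ y ∈ B, lHom G 1 x y)

/-- A homogeneous block of `G`: a maximal 1-homogeneous set of consecutive vertices. -/
def IsHomBlock {N : ℕ} (G : SimpleGraph (Fin N)) (B : Set (Fin N)) : Prop :=
  B.Nonempty ∧ IsHomInterval G B ∧ ∀ B' : Set (Fin N), B ⊆ B' → IsHomInterval G B' → B = B'

/-- `G` has at most `k` homogeneous blocks. -/
def HomBlocksLE {N : ℕ} (G : SimpleGraph (Fin N)) (k : ℕ) : Prop :=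
  {B : Set (Fin N) | IsHomBlock G B}.ncard ≤ k

/-- `TailBound G k M` : the homogeneous block sequence `t_1 ≥ t_2 ≥ …` of `G` satisfies
`Σ_{i=k+2}^∞ t_i ≤ M`, i.e. some (equivalently, the largest) `k+1` homogeneous blocks
cover all but at most `M` vertices. -/
def TailBound {N : ℕ} (G : SimpleGraph (Fin N)) (k M : ℕ) : Prop :=
  ∃ S : Finset (Set (Fin N)), S.card ≤ k + 1 ∧ (∀ B ∈ S, IsHomBlock G B) ∧
    {v : Fin N | ∀ B ∈ S, v ∉ B}.ncard ≤ M

/-- An ordered graph is irreducible if no pair of vertices `u < v` separates its edges. -/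
def IrredGraph {N : ℕ} (G : SimpleGraph (Fin N)) : Prop :=
  ¬ ∃ u v : Fin N, u < v ∧
      ∀ i j : Fin N, i < j → G.Adj i j → ((j : ℕ) ≤ (u : ℕ) ∨ (v : ℕ) ≤ (i : ℕ))

/-- `G` is `ℓ`-empty: it has no edges of length at least `ℓ`. -/
def lEmpty {N : ℕ} (G : SimpleGraph (Fin N)) (ℓ : ℕ) : Prop :=
  ∀ u v : Fin N, G.Adj u v → ((u : ℤ) - (v : ℤ)).natAbs < ℓ

/-- `IsFamSum G sz Gs` : `G = G_1 + … + G_s`, the consecutive sum of the ordered graphs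
`Gs 0, …, Gs (s-1)` (of orders `sz 0, …, sz (s-1)`), with no edges between summands. -/
def IsFamSum {N s : ℕ} (G : SimpleGraph (Fin N)) (sz : Fin s → ℕ)
    (Gs : ∀ i, SimpleGraph (Fin (sz i))) : Prop :=
  N = ∑ i, sz i ∧
  ∀ u v : Fin N, G.Adj u v ↔ ∃ (i : Fin s) (x y : Fin (sz i)),
    (Gs i).Adj x y ∧
    (u : ℕ) = (∑ j ∈ Finset.univ.filter (fun j => j < i), sz j) + (x : ℕ) ∧
    (v : ℕ) = (∑ j ∈ Finset.univ.filter (fun j => j < i), sz j) + (y : ℕ)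

/-- `(Gs 0, …, Gs (s-1))` is the irreducible block decomposition of `G`:
`G = G_1 + ⋯ + G_s` with every block nonempty and irreducible.  (Such a
decomposition is unique.) -/
def IsIrredDecomp {N s : ℕ} (G : SimpleGraph (Fin N)) (sz : Fin s → ℕ)
    (Gs : ∀ i, SimpleGraph (Fin (sz i))) : Prop :=
  IsFamSum G sz Gs ∧ (∀ i, 1 ≤ sz i) ∧ ∀ i, IrredGraph (Gs i)

/-- `J_1^{(n)} = K_n`. -/
def Jgraph1 (n : ℕ) : SimpleGraph (Fin n) := ⊤

/-- `J_2^{(n)}` : single edge `{1,n}`. -/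
def Jgraph2 (n : ℕ) : SimpleGraph (Fin n) :=
  SimpleGraph.fromRel (fun u v => (u : ℕ) = 0 ∧ (v : ℕ) = n - 1)

/-- `J_3^{(n)}` : star at the first vertex. -/
def Jgraph3 (n : ℕ) : SimpleGraph (Fin n) :=
  SimpleGraph.fromRel (fun u _ => (u : ℕ) = 0)

/-- `J_4^{(n)}` : star at the last vertex. -/
def Jgraph4 (n : ℕ) : SimpleGraph (Fin n) :=
  SimpleGraph.fromRel (fun _ v => (v : ℕ) = n - 1)

/-- `L^{(n)}` : the monotone path. -/
def Lgraph (n : ℕ) : SimpleGraph (Fin n) :=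
  SimpleGraph.fromRel (fun u v => (v : ℕ) = (u : ℕ) + 1)

/-- `Q_1` : edge set `{13, 24}` on `[4]`. -/
def Qgraph1 : SimpleGraph (Fin 4) :=
  SimpleGraph.fromRel (fun u v => ((u : ℕ) = 0 ∧ (v : ℕ) = 2) ∨ ((u : ℕ) = 1 ∧ (v : ℕ) = 3))

/-- `Q_2` : edge set `{14, 23}` on `[4]`. -/
def Qgraph2 : SimpleGraph (Fin 4) :=
  SimpleGraph.fromRel (fun u v => ((u : ℕ) = 0 ∧ (v : ℕ) = 3) ∨ ((u : ℕ) = 1 ∧ (v : ℕ) = 2))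

/-- `G` is order-isomorphic to a member of the family `𝒥`. -/
def InJ {n : ℕ} (G : SimpleGraph (Fin n)) : Prop :=
  G = Jgraph1 n ∨ G = Jgraph2 n ∨ G = Jgraph3 n ∨ G = Jgraph4 n ∨ G = Lgraph n ∨
  (n = 4 ∧ IndSub G Qgraph1) ∨ (n = 4 ∧ IndSub G Qgraph2)

/-- `G` is order-isomorphic to a member of `𝒥_ℓ`. -/
def InJle (ℓ : ℕ) {n : ℕ} (G : SimpleGraph (Fin n)) : Prop :=
  (n ≤ ℓ ∧ (G = Jgraph1 n ∨ G = Jgraph2 n ∨ G = Jgraph3 n ∨ G = Jgraph4 n ∨ G = Lgraph n)) ∨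
  (4 ≤ ℓ ∧ n = 4 ∧ (IndSub G Qgraph1 ∨ IndSub G Qgraph2))

/-- `A` is a sum `B_1 + ⋯ + B_t` of members of `𝒥_ℓ` which are pairwise comparable in
the induced ordered subgraph order. -/
def InJA (ℓ : ℕ) {n : ℕ} (A : SimpleGraph (Fin n)) : Prop :=
  ∃ (t : ℕ) (sz : Fin t → ℕ) (Bs : ∀ j, SimpleGraph (Fin (sz j))),
    IsFamSum A sz Bs ∧ (∀ j, InJle ℓ (Bs j)) ∧
    ∀ j j', IndSub (Bs j) (Bs j') ∨ IndSub (Bs j') (Bs j)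

/-- `G ∈ 𝒥(k,ℓ)`. -/
def InJkl (k ℓ : ℕ) {n : ℕ} (G : SimpleGraph (Fin n)) : Prop :=
  ∃ (s : ℕ) (sz : Fin s → ℕ) (As : ∀ i, SimpleGraph (Fin (sz i))),
    s ≤ k ∧ IsFamSum G sz As ∧ ∀ i, InJA ℓ (As i)

namespace OG

/-! ### Basic counting facts -/

lemma genFib_le_two_pow (k n : ℕ) : genFib k (n + 1) ≤ 2 ^ n := by
  induction n using Nat.strong_induction_on with
  | _ n ih =>
    rw [genFib]
    have h1 : ∑ i ∈ Finset.range k, (if i ≤ n then genFib k (n - i) else 0)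
        ≤ ∑ i ∈ Finset.range (n + 1), genFib k (n - i) := by
      rw [← Finset.sum_filter]
      apply Finset.sum_le_sum_of_subset
      intro i hi
      simp only [Finset.mem_filter, Finset.mem_range] at hi ⊢
      omega
    refine h1.trans ?_
    rw [Finset.sum_range_succ]
    have h2 : ∑ i ∈ Finset.range n, genFib k (n - i) ≤ ∑ i ∈ Finset.range n, 2 ^ (n - 1 - i) := by
      apply Finset.sum_le_sum
      intro i hi
      rw [Finset.mem_range] at hi
      have := ih (n - 1 - i) (by omega)
      rwa [show n - 1 - i + 1 = n - i by omega] at this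
    have h3 : ∑ i ∈ Finset.range n, 2 ^ (n - 1 - i) = ∑ i ∈ Finset.range n, 2 ^ i :=
      Finset.sum_range_reflect (fun i => 2 ^ i) n
    have h4 := Nat.geomSum_eq (le_refl 2) n
    have h5 : 1 ≤ 2 ^ n := Nat.one_le_two_pow
    simp only [Nat.sub_self, genFib]
    rw [h3, h4] at h2
    simp only [Nat.add_one_sub_one, Nat.div_one] at h2
    omega

/-- Fundamental counting lemma. -/
lemma speed_ge {α : Type*} (P : HerProp) {n N : ℕ} (A : SimpleGraph ℕ)
    (hA : A.comap (fun i : Fin N => (i : ℕ)) ∈ P.mem N) (W : Finset α) (f : α → ℕ → ℕ)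
    (hmono : ∀ w ∈ W, ∀ i j, i < j → j < n → f w i < f w j)
    (hlt : ∀ w ∈ W, ∀ i, i < n → f w i < N)
    (hinj : ∀ w ∈ W, ∀ w' ∈ W, (∀ i j, i < n → j < n →
      (A.Adj (f w i) (f w j) ↔ A.Adj (f w' i) (f w' j))) → w = w') :
    W.card ≤ speed P n := by
  classical
  let g : α → SimpleGraph (Fin n) := fun w => A.comap (fun i : Fin n => f w i)
  have hg : ∀ w ∈ W, g w ∈ P.mem n := by
    intro w hw
    refine P.hered _ _ ?_ hA
    refine ⟨OrderEmbedding.ofStrictMono (fun i : Fin n => ⟨f w i, hlt w hw i i.2⟩) ?_, ?_⟩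
    · intro i j hij
      exact hmono w hw i j hij j.2
    · intro i j
      exact Iff.rfl
  have hcard : (W.image g).card = W.card := by
    apply Finset.card_image_of_injOn
    intro w hw w' hw' h
    apply hinj w hw w' hw'
    intro i j hi hj
    have := congrArg (fun H : SimpleGraph (Fin n) => H.Adj ⟨i, hi⟩ ⟨j, hj⟩) h
    simpa [g] using this
  rw [← hcard, speed, ← Set.ncard_coe_finset]
  apply Set.ncard_le_ncard _ (Set.toFinite _)
  intro x hx
  simp only [Finset.coe_image, Set.mem_image] at hx
  obtain ⟨w, hw, rfl⟩ := hx
  exact hg w hw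

/-- The property of complements. -/
def cpl (P : HerProp) : HerProp where
  mem n := {G | Gᶜ ∈ P.mem n}
  hered := by
    rintro m n G H ⟨φ, hφ⟩ hH
    refine P.hered _ _ ⟨φ, ?_⟩ hH
    intro i j
    simp [hφ]

lemma speed_cpl (P : HerProp) (n : ℕ) : speed (cpl P) n = speed P n := by
  unfold speed
  apply Set.ncard_congr (fun G _ => Gᶜ)
  · intro G hG; exact hG
  · intro G H _ _ h; exact compl_injective h
  · intro G hG; exact ⟨Gᶜ, by simpa [cpl] using hG, by simp⟩

/-- The property of reversed graphs. -/
def rvs (P : HerProp) : HerProp where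
  mem n := {G | G.comap Fin.rev ∈ P.mem n}
  hered := by
    rintro m n G H ⟨φ, hφ⟩ hH
    refine P.hered _ _ ⟨OrderEmbedding.ofStrictMono (fun i => (φ i.rev).rev) ?_, ?_⟩ hH
    · intro i j hij
      simp [hij]
    · intro i j
      change _ ↔ H.Adj (φ i.rev).rev.rev (φ j.rev).rev.rev
      simp [hφ]

lemma speed_rvs (P : HerProp) (n : ℕ) : speed (rvs P) n = speed P n := by
  have h2 : ∀ G : SimpleGraph (Fin n), (G.comap Fin.rev).comap Fin.rev = G := by
    intro G; ext i j; simp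
  unfold speed
  apply Set.ncard_congr (fun G _ => G.comap Fin.rev)
  · intro G hG; exact hG
  · intro G H _ _ h
    rw [← h2 G, ← h2 H]; rw [h]
  · intro G hG; exact ⟨G.comap Fin.rev, by simpa [rvs, h2] using hG, h2 G⟩

lemma mem_cpl (P : HerProp) {N : ℕ} {A : SimpleGraph ℕ}
    (hA : A.comap (fun i : Fin N => (i : ℕ)) ∈ P.mem N) :
    (Aᶜ).comap (fun i : Fin N => (i : ℕ)) ∈ (cpl P).mem N := by
  have : ((Aᶜ).comap (fun i : Fin N => (i : ℕ)))ᶜ = A.comap (fun i : Fin N => (i : ℕ)) := by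
    ext i j
    simp only [SimpleGraph.compl_adj, SimpleGraph.comap_adj, not_and, not_not, Fin.ext_iff, ne_eq]
    constructor
    · rintro ⟨h1, h2⟩; exact h2 h1
    · intro h; exact ⟨fun h' => A.ne_of_adj h h', fun _ => h⟩
  simp only [cpl, Set.mem_ofPred_eq, this]
  exact hA

/-- reversal of a graph on `[0,N)` -/
def rvg (N : ℕ) (A : SimpleGraph ℕ) : SimpleGraph ℕ := A.comap (fun i => N - 1 - i)

lemma mem_rvs (P : HerProp) {N : ℕ} {A : SimpleGraph ℕ}
    (hA : A.comap (fun i : Fin N => (i : ℕ)) ∈ P.mem N) :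
    (rvg N A).comap (fun i : Fin N => (i : ℕ)) ∈ (rvs P).mem N := by
  have : ((rvg N A).comap (fun i : Fin N => (i : ℕ))).comap Fin.rev
      = A.comap (fun i : Fin N => (i : ℕ)) := by
    ext i j
    simp only [rvg, SimpleGraph.comap_adj, Fin.val_rev]
    rw [show N - 1 - (N - (↑i + 1)) = (i : ℕ) by omega,
      show N - 1 - (N - (↑j + 1)) = (j : ℕ) by omega]
  simp only [rvs, Set.mem_ofPred_eq, this]
  exact hA

/-! ### Ramsey -/

lemma pick_seq (S : Finset ℕ) : ∃ f : ℕ → ℕ, (∀ i < S.card, f i ∈ S) ∧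
    ∀ i j, i < j → j < S.card → f i < f j := by
  refine ⟨fun i => if h : i < S.card then S.orderEmbOfFin rfl ⟨i, h⟩ else 0, ?_, ?_⟩
  · intro i hi
    simp [hi]
  · intro i j hij hj
    have hi : i < S.card := hij.trans hj
    simp [hi, hj, hij]

lemma pigeon {κ : Type*} [Finite κ] (m : ℕ) : ∃ R : ℕ, ∀ (c : ℕ → κ) (S : Finset ℕ),
    R ≤ S.card → ∃ k, ∃ T ⊆ S, m ≤ T.card ∧ ∀ x ∈ T, c x = k := by
  classical
  have := Fintype.ofFinite κ
  refine ⟨Fintype.card κ * m + 1, ?_⟩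
  intro c S hS
  obtain ⟨k, -, hk⟩ := Finset.exists_lt_card_fiber_of_mul_lt_card_of_maps_to
    (s := S) (t := (Finset.univ : Finset κ)) (f := c) (n := m) (by simp)
    (by rw [Finset.card_univ]; omega)
  exact ⟨k, S.filter (fun x => c x = k), Finset.filter_subset _ _, hk.le, by simp⟩

lemma pre_ramsey {κ : Type*} [Finite κ] (m : ℕ) : ∃ R : ℕ, ∀ (c : ℕ → ℕ → κ) (S : Finset ℕ),
    R ≤ S.card → ∃ (f : ℕ → ℕ) (g : ℕ → κ), (∀ i < m, f i ∈ S) ∧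
      ∀ i j, i < j → j < m → f i < f j ∧ c (f i) (f j) = g i := by
  classical
  induction m with
  | zero =>
    refine ⟨1, fun c S hS => ?_⟩
    obtain ⟨s, hs⟩ : S.Nonempty := Finset.card_pos.mp (by omega)
    exact ⟨fun _ => 0, fun _ => c s s, by simp, by simp⟩
  | succ m ih =>
    obtain ⟨R, hR⟩ := ih
    obtain ⟨R', hR'⟩ := pigeon (κ := κ) R
    refine ⟨R' + 1, fun c S hS => ?_⟩
    have hne : S.Nonempty := Finset.card_pos.mp (by omega)
    let s := S.min' hne
    have hs : s ∈ S := S.min'_mem hne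
    obtain ⟨k, T, hTS, hT, hk⟩ := hR' (c s) (S.erase s)
      (by rw [Finset.card_erase_of_mem hs]; omega)
    obtain ⟨f, g, hf, hfg⟩ := hR c T hT
    refine ⟨fun i => if i = 0 then s else f (i - 1), fun i => if i = 0 then k else g (i - 1), ?_, ?_⟩
    · intro i hi
      by_cases h0 : i = 0
      · simp [h0, hs]
      · simp only [h0, if_false]
        exact Finset.mem_of_mem_erase (hTS (hf _ (by omega)))
    · intro i j hij hj
      have hj0 : j ≠ 0 := by omega
      have hfj := hf (j - 1) (by omega)
      by_cases h0 : i = 0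
      · simp only [h0, hj0, if_true, if_false]
        refine ⟨?_, hk _ hfj⟩
        have h1 := hTS hfj
        rw [Finset.mem_erase] at h1
        exact lt_of_le_of_ne (S.min'_le _ h1.2) (Ne.symm h1.1)
      · simp only [h0, hj0, if_false]
        exact hfg (i - 1) (j - 1) (by omega) (by omega)

lemma ramsey {κ : Type*} [Finite κ] (m : ℕ) : ∃ R : ℕ, ∀ (c : ℕ → ℕ → κ),
    ∃ (f : ℕ → ℕ) (k : κ), (∀ i < m, f i < R) ∧
      ∀ i j, i < j → j < m → f i < f j ∧ c (f i) (f j) = k := by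
  obtain ⟨R₁, h₁⟩ := pigeon (κ := κ) m
  obtain ⟨R, hR⟩ := pre_ramsey (κ := κ) R₁
  refine ⟨R, fun c => ?_⟩
  obtain ⟨f, g, hf, hfg⟩ := hR c (Finset.range R) (by simp)
  obtain ⟨k, T, hT, hmT, hk⟩ := h₁ g (Finset.range R₁) (by simp)
  obtain ⟨e, he, hem⟩ := pick_seq T
  have hlt : ∀ i < m, e i < R₁ := fun i hi =>
    Finset.mem_range.mp (hT (he i (by omega)))
  refine ⟨fun i => f (e i), k, fun i hi => Finset.mem_range.mp (hf _ (hlt i hi)), ?_⟩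
  intro i j hij hj
  have h := hfg (e i) (e j) (hem i j hij (by omega)) (hlt j hj)
  exact ⟨h.1, h.2.trans (hk _ (he i (by omega)))⟩

end OG

namespace OG

/-! ### Structures of Type 1 -/

lemma type1 (P : HerProp) {n N : ℕ} (A : SimpleGraph ℕ)
    (hA : A.comap (fun i : Fin N => (i : ℕ)) ∈ P.mem N) (hn : 1 ≤ n)
    (y : ℕ) (X : Bool → ℕ → ℕ)
    (hX : ∀ a b i j, i < j → j < n - 1 → X a i < X b j)
    (hN : ∀ a i, i < n - 1 → X a i < N) (hy : y < N)
    (hside : (∀ a i, i < n - 1 → y < X a i) ∨ (∀ a i, i < n - 1 → X a i < y))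
    (hadj : ∀ i, i < n - 1 → A.Adj y (X true i) ∧ ¬ A.Adj y (X false i)) :
    2 ^ (n - 1) ≤ speed P n := by
  classical
  have hcard : ((Finset.range (n - 1)).powerset).card = 2 ^ (n - 1) := by simp
  have hadj' : ∀ a i, i < n - 1 → (A.Adj y (X a i) ↔ a = true) := by
    intro a i hi
    have := hadj i hi
    cases a <;> simp [this]
  rw [← hcard]
  rcases hside with hs | hs
  · refine speed_ge P A hA _ (fun S i => if i = 0 then y else X (decide (i - 1 ∈ S)) (i - 1)) ?_ ?_ ?_
    · intro S _ i j hij hj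
      have hj0 : j ≠ 0 := by omega
      by_cases h0 : i = 0
      · simp only [h0, hj0, if_true, if_false]
        exact hs _ _ (by omega)
      · simp only [h0, hj0, if_false]
        exact hX _ _ _ _ (by omega) (by omega)
    · intro S _ i hi
      by_cases h0 : i = 0
      · simp [h0, hy]
      · simp only [h0, if_false]
        exact hN _ _ (by omega)
    · intro S hS S' hS' h
      rw [Finset.mem_powerset] at hS hS'
      have key : ∀ i, i < n - 1 → (i ∈ S ↔ i ∈ S') := by
        intro i hi
        have := h 0 (i + 1) (by omega) (by omega)
        simpa [hadj' _ _ hi] using this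
      ext i
      by_cases hi : i < n - 1
      · exact key i hi
      · exact ⟨fun h => absurd (Finset.mem_range.mp (hS h)) hi,
          fun h => absurd (Finset.mem_range.mp (hS' h)) hi⟩
  · refine speed_ge P A hA _ (fun S i => if i < n - 1 then X (decide (i ∈ S)) i else y) ?_ ?_ ?_
    · intro S _ i j hij hj
      have hi : i < n - 1 := by omega
      by_cases h0 : j < n - 1
      · simp only [hi, h0, if_true]
        exact hX _ _ _ _ hij h0
      · simp only [hi, h0, if_true, if_false]
        exact hs _ _ hi
    · intro S _ i hi
      by_cases h0 : i < n - 1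
      · simp only [h0, if_true]
        exact hN _ _ h0
      · simp [h0, hy]
    · intro S hS S' hS' h
      rw [Finset.mem_powerset] at hS hS'
      have key : ∀ i, i < n - 1 → (i ∈ S ↔ i ∈ S') := by
        intro i hi
        have := h (n - 1) i (by omega) (by omega)
        simpa [hadj' _ _ hi, hi] using this
      ext i
      by_cases hi : i < n - 1
      · exact key i hi
      · exact ⟨fun h => absurd (Finset.mem_range.mp (hS h)) hi,
          fun h => absurd (Finset.mem_range.mp (hS' h)) hi⟩

/-! ### Structures of Type 2 -/

open Classical in
lemma count_not (w : ℕ → Prop) (n : ℕ) :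
    Nat.count w n + Nat.count (fun p => ¬ w p) n = n := by
  induction n with
  | zero => simp
  | succ n ih =>
    rw [Nat.count_succ, Nat.count_succ]
    by_cases h : w n <;> simp [h] <;> omega

lemma count_congr' {w w' : ℕ → Prop} [DecidablePred w] [DecidablePred w'] {p : ℕ} (h : ∀ q < p, w q ↔ w' q) :
    Nat.count w p = Nat.count w' p :=
  le_antisymm (Nat.count_mono_left fun k hk => (h k hk).1)
    (Nat.count_mono_left fun k hk => (h k hk).2)

open Classical in
lemma word_step {n a : ℕ} {w w' : ℕ → Prop}
    (hw : (Set.ofPred w).Infinite) (hwn : (Set.ofPred (fun p => ¬ w p)).Infinite)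
    (hw' : (Set.ofPred w').Infinite)
    (ha : Nat.count w n = a) (ha' : Nat.count w' n = a)
    (I : Prop) (cell cell' : ℕ → ℕ → Prop)
    (h2 : ∀ r c, r < a → c < n - a →
      Nat.nth (fun p => ¬ w p) c = Nat.nth w r + 1 → (cell r c ↔ ¬ I))
    (h1' : ∀ r c, r < a → c < n - a →
      Nat.nth (fun p => ¬ w' p) c < Nat.nth w' r → (cell' r c ↔ I))
    (heq : ∀ r c, r < a → c < n - a → (cell r c ↔ cell' r c))
    (p : ℕ) (hp : p < n) (hpre : ∀ q < p, w q ↔ w' q) (hwp : w p) (hwp' : ¬ w' p) : False := by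
  set c := Nat.count (fun p => ¬ w p) p with hc
  have hc' : Nat.count (fun p => ¬ w' p) p = c :=
    (count_congr' (fun q hq => not_congr (hpre q hq))).symm
  have hb := count_not w n
  have hb' := count_not w' n
  have hcb : c < n - a := by
    have : Nat.count (fun p => ¬ w' p) p < Nat.count (fun p => ¬ w' p) n :=
      Nat.count_strict_mono (p := fun p => ¬ w' p) hwp' hp
    omega
  set q := Nat.nth (fun p => ¬ w p) c with hq
  have hpq : p ≤ q := Nat.le_nth_count (p := fun p => ¬ w p) hwn p
  have hwq : ¬ w q := Nat.nth_mem_of_infinite hwn c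
  have hne : p ≠ q := by intro h; exact hwq (h ▸ hwp)
  have hqn : q < n := Nat.nth_lt_of_lt_count (p := fun p => ¬ w p) (by omega)
  have hcq : Nat.count (fun p => ¬ w p) q = c := Nat.count_nth_of_infinite hwn c
  have hwq1 : w (q - 1) := by
    by_contra hcon
    have h1 : Nat.count (fun p => ¬ w p) (q - 1) < Nat.count (fun p => ¬ w p) q :=
      Nat.count_strict_mono (p := fun p => ¬ w p) hcon (by omega)
    have h2 : Nat.count (fun p => ¬ w p) p ≤ Nat.count (fun p => ¬ w p) (q - 1) :=
      Nat.count_monotone _ (by omega)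
    omega
  set r := Nat.count w (q - 1) with hr
  have hnr : Nat.nth w r = q - 1 := Nat.nth_count hwq1
  have hra : r < a := by
    rw [← ha]; exact Nat.count_strict_mono hwq1 (by omega)
  have e1 := h2 r c hra hcb (by rw [hnr]; omega)
  have hnp : Nat.nth (fun p => ¬ w' p) c = p := by
    rw [← hc']; exact Nat.nth_count (p := fun p => ¬ w' p) hwp'
  have hle : p ≤ Nat.nth w' r := by
    rw [← Nat.count_le_iff_le_nth hw', ← count_congr' hpre]
    exact Nat.count_monotone _ (by omega)
  have hmem : w' (Nat.nth w' r) := Nat.nth_mem_of_infinite hw' r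
  have hne2 : p ≠ Nat.nth w' r := by
    intro h; rw [← h] at hmem; exact hwp' hmem
  have e2 := h1' r c hra hcb (by rw [hnp]; omega)
  have e3 := heq r c hra hcb
  tauto

/-- extension of a finite word to an infinite one -/
def ww (n : ℕ) (S : Finset ℕ) (p : ℕ) : Prop := (p < n ∧ p ∈ S) ∨ (n ≤ p ∧ Even p)

lemma ww_inf (n : ℕ) (S : Finset ℕ) : (Set.ofPred (ww n S)).Infinite := by
  apply Set.infinite_of_forall_exists_gt
  intro a
  exact ⟨2 * (a + n + 1), Or.inr ⟨by omega, by simp⟩, by omega⟩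

lemma ww_inf' (n : ℕ) (S : Finset ℕ) : (Set.ofPred (fun p => ¬ ww n S p)).Infinite := by
  apply Set.infinite_of_forall_exists_gt
  intro a
  refine ⟨2 * (a + n + 1) + 1, ?_, by omega⟩
  change ¬ ww n S _
  rintro (h | h)
  · omega
  · exact absurd h.2 (by simp)

open Classical in
/-- index of the column used at position `q` -/
noncomputable def cidx (n : ℕ) (S : Finset ℕ) (q : ℕ) : ℕ :=
  if 1 ≤ q ∧ ww n S (q - 1) then q - 1 else q

lemma cidx_le (n : ℕ) (S : Finset ℕ) (q : ℕ) : cidx n S q ≤ q := by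
  unfold cidx; split_ifs <;> omega

lemma cidx_lt (n : ℕ) (S : Finset ℕ) {q q' : ℕ} (h : q < q') (hq : ¬ ww n S q) :
    cidx n S q < cidx n S q' := by
  unfold cidx
  split_ifs with h1 h2 h3
  · omega
  · omega
  · have : q' - 1 ≠ q := by
      intro h'; rw [h'] at h3; exact hq h3.2
    omega
  · omega

lemma type2 (P : HerProp) {n N : ℕ} (A : SimpleGraph ℕ)
    (hA : A.comap (fun i : Fin N => (i : ℕ)) ∈ P.mem N) (hn : 1 ≤ n)
    (y : ℕ → ℕ) (X : Bool → ℕ → ℕ) (I : Prop)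
    (hX : ∀ a b i j, i < j → j < n → X a i < X b j)
    (hXy : ∀ a i j, i < n → j < n → X a i < y j)
    (hN : ∀ i, i < n → y i < N)
    (hy : (∀ i j, i < j → j < n → y i < y j) ∨ (∀ i j, i < j → j < n → y j < y i))
    (hyy : ∀ i j, i < n → j < n → ¬ A.Adj (y i) (y j))
    (hd : ∀ i, i < n → A.Adj (X true i) (y i) ∧ ¬ A.Adj (X false i) (y i))
    (hI : ∀ a i j, i < j → j < n → (A.Adj (X a j) (y i) ↔ I)) :
    2 ^ (n - 1) ≤ speed P n := by
  classical
  -- the column index for position `i` in the graph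
  let d : Bool := decide (¬ I)
  have hdd : ∀ i, i < n → (A.Adj (X d i) (y i) ↔ ¬ I) := by
    intro i hi
    have := hd i hi
    by_cases hI : I <;> simp [d, hI, this]
  let cnt : Finset ℕ → ℕ := fun S => Nat.count (ww n S) n
  let good : Finset ℕ → Prop := fun S => cnt S = 0 ∨
    (I ∧ ww n S (n - 1) ∧ cnt S < n) ∨ (¬ I ∧ ¬ ww n S (n - 1))
  let W := (Finset.range n).powerset.filter good
  let row : Finset ℕ → ℕ → ℕ := fun S i => Nat.nth (ww n S) i
  let col : Finset ℕ → ℕ → ℕ := fun S i => Nat.nth (fun p => ¬ ww n S p) i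
  have hcn : ∀ S, cnt S + Nat.count (fun p => ¬ ww n S p) n = n := fun S => count_not _ _
  have hcl : ∀ S, cnt S ≤ n := fun S => Nat.count_le _
  have rown : ∀ S i, i < cnt S → row S i < n := fun S i hi => Nat.nth_lt_of_lt_count hi
  have coln : ∀ S i, i < n - cnt S → col S i < n := fun S i hi =>
    Nat.nth_lt_of_lt_count (p := fun p => ¬ ww n S p) (by have := hcn S; omega)
  have rowm : ∀ S i j, i < j → row S i < row S j := fun S i j h =>
    Nat.nth_strictMono (ww_inf n S) h
  have colm : ∀ S i j, i < j → col S i < col S j := fun S i j h =>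
    Nat.nth_strictMono (ww_inf' n S) h
  have colw : ∀ S i, ¬ ww n S (col S i) := fun S i => Nat.nth_mem_of_infinite (ww_inf' n S) i
  have roww : ∀ S i, ww n S (row S i) := fun S i => Nat.nth_mem_of_infinite (ww_inf n S) i
  have cin : ∀ S i, i < n - cnt S → cidx n S (col S i) < n := fun S i hi =>
    (cidx_le _ _ _).trans_lt (coln S i hi)
  have cim : ∀ S i j, i < j → cidx n S (col S i) < cidx n S (col S j) := fun S i j h =>
    cidx_lt n S (colm S i j h) (colw S i)
  let cell : Finset ℕ → ℕ → ℕ → Prop := fun S r c =>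
    A.Adj (X d (row S r)) (y (cidx n S (col S c)))
  have cell1 : ∀ S r c, r < cnt S → c < n - cnt S → col S c < row S r → (cell S r c ↔ I) := by
    intro S r c hr hc h
    exact hI _ _ _ ((cidx_le _ _ _).trans_lt h) (rown S r hr)
  have cell2 : ∀ S r c, r < cnt S → c < n - cnt S → col S c = row S r + 1 →
      (cell S r c ↔ ¬ I) := by
    intro S r c hr hc h
    have : cidx n S (col S c) = row S r := by
      unfold cidx
      rw [if_pos]
      · omega
      · refine ⟨by omega, ?_⟩
        rw [h]; exact roww S r
    simp only [cell, this]
    exact hdd _ (rown S r hr)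
  -- nonzero last row
  have last : ∀ S, good S → 0 < cnt S → ∃ c < n - cnt S, cell S (cnt S - 1) c := by
    intro S hS h0
    rcases hS with h | ⟨hi, hl, hlt⟩ | ⟨hi, hl⟩
    · omega
    · refine ⟨0, by omega, ?_⟩
      rw [cell1 S _ _ (by omega) (by omega)]
      · exact hi
      · have h1 : Nat.count (ww n S) (n - 1) = cnt S - 1 := by
          have : cnt S = Nat.count (ww n S) (n - 1 + 1) := by
            simp only [cnt]; congr 1; omega
          rw [Nat.count_succ, if_pos hl] at this
          omega
        have h2 : row S (cnt S - 1) = n - 1 := by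
          rw [← h1]; exact Nat.nth_count hl
        rw [h2]
        have h3 := coln S 0 (by omega)
        have h4 := colw S 0
        have : col S 0 ≠ n - 1 := by
          intro h; rw [h] at h4; exact h4 hl
        omega
    · -- the last row is followed by a column
      set q := row S (cnt S - 1) + 1 with hq
      have hqn : row S (cnt S - 1) < n := rown S _ (by omega)
      have hql : row S (cnt S - 1) ≠ n - 1 := by
        intro h; have := roww S (cnt S - 1); rw [h] at this; exact hl this
      have hwq : ¬ ww n S q := by
        intro hw
        have h1 : Nat.count (ww n S) q = cnt S := by
          have := Nat.count_nth_succ_of_infinite (ww_inf n S) (cnt S - 1)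
          change Nat.count (ww n S) q = _ at this
          omega
        have h2 : Nat.count (ww n S) q < Nat.count (ww n S) n :=
          Nat.count_strict_mono hw (by omega)
        change _ < cnt S at h2
        omega
      refine ⟨Nat.count (fun p => ¬ ww n S p) q, ?_, ?_⟩
      · have : Nat.count (fun p => ¬ ww n S p) q < Nat.count (fun p => ¬ ww n S p) n :=
          Nat.count_strict_mono (p := fun p => ¬ ww n S p) hwq (by omega)
        have := hcn S
        omega
      · have hlt : Nat.count (fun p => ¬ ww n S p) q < n - cnt S := by
          have : Nat.count (fun p => ¬ ww n S p) q < Nat.count (fun p => ¬ ww n S p) n :=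
            Nat.count_strict_mono (p := fun p => ¬ ww n S p) hwq (by omega)
          have := hcn S
          omega
        rw [cell2 S _ _ (by omega) hlt]
        · exact hi
        · exact Nat.nth_count (p := fun p => ¬ ww n S p) hwq
  -- cardinality
  have hWcard : 2 ^ (n - 1) ≤ W.card := by
    have hc : ((Finset.range (n - 1)).powerset).card = 2 ^ (n - 1) := by simp
    rw [← hc]
    by_cases hi : I
    · let g : Finset ℕ → Finset ℕ := fun S =>
        if S = Finset.range (n - 1) then ∅ else insert (n - 1) S
      apply Finset.card_le_card_of_injOn g
      · intro S hS
        rw [Finset.mem_coe, Finset.mem_powerset] at hS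
        by_cases h : S = Finset.range (n - 1)
        · simp only [g, h, if_true, W, Finset.coe_filter, Set.mem_ofPred_eq, Finset.mem_powerset]
          refine ⟨by simp, Or.inl ?_⟩
          simp only [cnt]
          rw [Nat.count_iff_forall_not]
          rintro m hm (h | h)
          · simp at h
          · omega
        · simp only [g, h, if_false, W, Finset.coe_filter, Set.mem_ofPred_eq, Finset.mem_powerset]
          refine ⟨?_, Or.inr (Or.inl ⟨hi, Or.inl ⟨by omega, by simp⟩, ?_⟩)⟩
          · intro x hx
            rw [Finset.mem_insert] at hx
            rw [Finset.mem_range]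
            rcases hx with hx | hx
            · omega
            · have := Finset.mem_range.mp (hS hx); omega
          · refine lt_of_le_of_ne (hcl _) ?_
            intro h'
            simp only [cnt] at h'
            rw [Nat.count_iff_forall] at h'
            apply h
            apply Finset.Subset.antisymm hS
            intro x hx
            rw [Finset.mem_range] at hx
            rcases h' x (by omega) with h'' | h''
            · have := h''.2
              rw [Finset.mem_insert] at this
              rcases this with h3 | h3
              · omega
              · exact h3
            · omega
      · intro S hS S' hS' h
        rw [Finset.mem_coe, Finset.mem_powerset] at hS hS'
        have hnS : n - 1 ∉ S := fun h => by have := Finset.mem_range.mp (hS h); omega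
        have hnS' : n - 1 ∉ S' := fun h => by have := Finset.mem_range.mp (hS' h); omega
        simp only [g] at h
        split_ifs at h with h1 h2 h2
        · rw [h1, h2]
        · have : n - 1 ∈ (∅ : Finset ℕ) := by rw [h]; simp
          simp at this
        · have : n - 1 ∈ (∅ : Finset ℕ) := by rw [← h]; simp
          simp at this
        · rw [← Finset.erase_insert hnS, h, Finset.erase_insert hnS']
    · apply Finset.card_le_card
      intro S hS
      rw [Finset.mem_powerset] at hS
      simp only [W, Finset.mem_filter, Finset.mem_powerset]
      refine ⟨hS.trans (by intro x; simp; omega), Or.inr (Or.inr ⟨hi, ?_⟩)⟩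
      rintro (h | h)
      · have := Finset.mem_range.mp (hS h.2); omega
      · omega
  refine hWcard.trans ?_
  -- position of column c
  obtain ⟨pos, hp1, hp2, hp3⟩ : ∃ pos : ℕ → ℕ → ℕ,
      (∀ a i, a ≤ i → i < n → pos a i < n - a) ∧
      (∀ a c, a ≤ n → c < n - a → ∃ i, a ≤ i ∧ i < n ∧ pos a i = c) ∧
      (∀ S i j, cnt S ≤ i → i < j → j < n →
        y (cidx n S (col S (pos (cnt S) i))) < y (cidx n S (col S (pos (cnt S) j)))) := by
    rcases hy with hy | hy
    · refine ⟨fun a i => i - a, by intros; dsimp only; omega, ?_, ?_⟩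
      · intro a c ha hc
        exact ⟨a + c, by omega, by omega, by dsimp only; omega⟩
      · intro S i j hi hij hj
        exact hy _ _ (cim _ _ _ (by dsimp only; omega)) (cin _ _ (by dsimp only; omega))
    · refine ⟨fun a i => n - 1 - i, by intros; dsimp only; omega, ?_, ?_⟩
      · intro a c ha hc
        exact ⟨n - 1 - c, by omega, by omega, by dsimp only; omega⟩
      · intro S i j hi hij hj
        exact hy _ _ (cim _ _ _ (by dsimp only; omega)) (cin _ _ (by dsimp only; omega))
  let f : Finset ℕ → ℕ → ℕ := fun S i =>
    if i < cnt S then X d (row S i) else y (cidx n S (col S (pos (cnt S) i)))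
  have fX : ∀ S i, i < cnt S → f S i = X d (row S i) := fun S i h => by simp only [f, h, if_true]
  have fY : ∀ S i, cnt S ≤ i → f S i = y (cidx n S (col S (pos (cnt S) i))) := fun S i h => by
    simp only [f, not_lt.mpr h, if_false]
  refine speed_ge P A hA W f ?_ ?_ ?_
  · intro S _ i j hij hj
    by_cases hi : i < cnt S
    · rw [fX S i hi]
      by_cases hj' : j < cnt S
      · rw [fX S j hj']
        exact hX _ _ _ _ (rowm S i j hij) (rown S j hj')
      · rw [fY S j (by omega)]
        exact hXy _ _ _ (rown S i hi) (cin S _ (hp1 _ _ (by omega) hj))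
    · rw [fY S i (by omega), fY S j (by omega)]
      exact hp3 S i j (by omega) hij hj
  · intro S _ i hi
    by_cases hi' : i < cnt S
    · rw [fX S i hi']
      exact (hXy d _ 0 (rown S i hi') (by omega)).trans (hN 0 (by omega))
    · rw [fY S i (by omega)]
      exact hN _ (cin S _ (hp1 _ _ (by omega) hi))
  · -- sizes agree
    have hsz : ∀ S ∈ W, ∀ S' ∈ W, (∀ i j, i < n → j < n →
        (A.Adj (f S i) (f S j) ↔ A.Adj (f S' i) (f S' j))) → ¬ cnt S < cnt S' := by
      intro S hS S' hS' h hlt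
      have hg' : good S' := (Finset.mem_filter.mp hS').2
      obtain ⟨c, hc, hcell⟩ := last S' hg' (by omega)
      obtain ⟨j, hj1, hj2, hj3⟩ := hp2 (cnt S') c (hcl _) hc
      have h1 := (h (cnt S' - 1) j (by have := hcl S'; omega) hj2).2
        (by rw [fX S' _ (by omega), fY S' j hj1, hj3]; exact hcell)
      rw [fY S _ (by omega), fY S _ (by omega)] at h1
      have := hcl S'
      exact hyy _ _ (cin S _ (hp1 _ _ (by omega) (by omega)))
        (cin S _ (hp1 _ _ (by omega) hj2)) h1
    intro S hS S' hS' h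
    have hcc : cnt S = cnt S' := by
      have h1 := hsz S hS S' hS' h
      have h2 := hsz S' hS' S hS (fun i j hi hj => (h i j hi hj).symm)
      omega
    have hcell : ∀ r c, r < cnt S → c < n - cnt S → (cell S r c ↔ cell S' r c) := by
      intro r c hr hc
      obtain ⟨j, hj1, hj2, hj3⟩ := hp2 (cnt S) c (hcl _) hc
      have h1 := h r j (by omega) hj2
      rw [fX S r hr, fY S j hj1, fX S' r (by omega), fY S' j (by omega), ← hcc, hj3] at h1
      exact h1
    have hword : ∀ p, p < n → (ww n S p ↔ ww n S' p) := by
      intro p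
      induction p using Nat.strong_induction_on with
      | _ p ih =>
        intro hp
        have hpre : ∀ q < p, (ww n S q ↔ ww n S' q) := fun q hq => ih q hq (hq.trans hp)
        constructor
        · intro h1
          by_contra h2
          exact word_step (ww_inf n S) (ww_inf' n S) (ww_inf n S') (a := cnt S) rfl hcc.symm I
            (cell S) (cell S') (cell2 S) (by rw [hcc]; exact cell1 S') hcell p hp hpre h1 h2
        · intro h1
          by_contra h2
          exact word_step (ww_inf n S') (ww_inf' n S') (ww_inf n S) (a := cnt S') rfl hcc I
            (cell S') (cell S) (cell2 S') (by rw [← hcc]; exact cell1 S)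
            (by rw [← hcc]; exact fun r c hr hc => (hcell r c hr hc).symm) p hp
            (fun q hq => (hpre q hq).symm) h1 h2
    have hS1 := Finset.mem_powerset.mp (Finset.mem_filter.mp hS).1
    have hS1' := Finset.mem_powerset.mp (Finset.mem_filter.mp hS').1
    ext p
    constructor
    · intro hp
      have hpn := Finset.mem_range.mp (hS1 hp)
      rcases (hword p hpn).1 (Or.inl ⟨hpn, hp⟩) with h | h
      · exact h.2
      · omega
    · intro hp
      have hpn := Finset.mem_range.mp (hS1' hp)
      rcases (hword p hpn).2 (Or.inl ⟨hpn, hp⟩) with h | h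
      · exact h.2
      · omega

end OG

namespace OG

/-- the sequence `S 0 < S 1 < ... < S (m-1)` spans an irreducible ordered graph -/
def Irr (A : ℕ → ℕ → Prop) (m : ℕ) (S : ℕ → ℕ) : Prop :=
  ∀ g, 0 < g → g < m → ∃ i < g, ∃ j, g ≤ j ∧ j < m ∧ A (S i) (S j)

/-- concatenation -/
def cat (L : ℕ → ℕ × Bool → ℕ → ℕ) : List (ℕ × Bool) → ℕ → ℕ → ℕ
  | [], _ => fun _ => 0
  | τ :: w, i0 => fun p => if p < τ.1 then L i0 τ p else cat L w (i0 + 1) (p - τ.1)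

/-- total length -/
def tot : List (ℕ × Bool) → ℕ
  | [] => 0
  | τ :: w => τ.1 + tot w

lemma words_exist (T : Finset (ℕ × Bool)) (hT : ∀ τ ∈ T, 1 ≤ τ.1) (a : ℕ → ℕ) (h0 : a 0 ≤ 1)
    (ha : ∀ n, a (n + 1) ≤ ∑ τ ∈ T, if τ.1 ≤ n + 1 then a (n + 1 - τ.1) else 0) (n : ℕ) :
    ∃ W : Finset (List (ℕ × Bool)), (∀ w ∈ W, (∀ τ ∈ w, τ ∈ T) ∧ tot w = n) ∧ a n ≤ W.card := by
  classical
  induction n using Nat.strong_induction_on with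
  | _ n ih =>
    rcases n with _ | n
    · exact ⟨{[]}, by simp [tot], by simpa using h0⟩
    · have key : ∀ τ : ℕ × Bool, ∃ W : Finset (List (ℕ × Bool)),
          (∀ w ∈ W, ∃ w', w = τ :: w' ∧ τ ∈ T ∧ (∀ τ ∈ w', τ ∈ T) ∧ tot w = n + 1) ∧
          (τ ∈ T → (if τ.1 ≤ n + 1 then a (n + 1 - τ.1) else 0) ≤ W.card) := by
        intro τ
        by_cases h : τ.1 ≤ n + 1 ∧ τ ∈ T
        · have h1 := hT τ h.2
          obtain ⟨W, hW, hc⟩ := ih (n + 1 - τ.1) (by omega)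
          refine ⟨W.image (fun w => τ :: w), ?_, ?_⟩
          · intro w hw
            obtain ⟨w', hw', rfl⟩ := Finset.mem_image.mp hw
            obtain ⟨h2, h3⟩ := hW w' hw'
            exact ⟨w', rfl, h.2, h2, by simp only [tot]; omega⟩
          · intro _
            rw [if_pos h.1, Finset.card_image_of_injective _ (fun _ _ h => List.tail_eq_of_cons_eq h)]
            exact hc
        · refine ⟨∅, by simp, ?_⟩
          intro hτ
          rw [if_neg (fun h' => h ⟨h', hτ⟩)]
          simp
      choose W hW hc using key
      refine ⟨T.biUnion W, ?_, ?_⟩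
      · intro w hw
        obtain ⟨τ, hτ, hw⟩ := Finset.mem_biUnion.mp hw
        obtain ⟨w', rfl, h1, h2, h3⟩ := hW τ w hw
        refine ⟨?_, h3⟩
        intro σ hσ
        rcases List.mem_cons.mp hσ with rfl | h
        · exact h1
        · exact h2 _ h
      · rw [Finset.card_biUnion]
        · exact (ha n).trans (Finset.sum_le_sum fun τ hτ => hc τ hτ)
        · intro τ _ σ _ hne
          change Disjoint (W τ) (W σ)
          rw [Finset.disjoint_left]
          intro w h1 h2
          obtain ⟨_, rfl, _⟩ := hW τ w h1
          obtain ⟨_, h, _⟩ := hW σ _ h2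
          exact hne (List.head_eq_of_cons_eq h)

lemma sum_speed (P : HerProp) {n N : ℕ} (A : SimpleGraph ℕ)
    (hA : A.comap (fun i : Fin N => (i : ℕ)) ∈ P.mem N)
    (T : Finset (ℕ × Bool)) (hT : ∀ τ ∈ T, 1 ≤ τ.1)
    (L : ℕ → ℕ × Bool → ℕ → ℕ)
    (hmono : ∀ i τ p q, i < n → τ ∈ T → p < q → q < τ.1 → L i τ p < L i τ q)
    (hcross : ∀ i j τ σ p q, i < j → j < n → τ ∈ T → σ ∈ T → p < τ.1 → q < σ.1 →
      L i τ p < L j σ q ∧ ¬ A.Adj (L i τ p) (L j σ q))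
    (hN : ∀ i τ p, i < n → τ ∈ T → p < τ.1 → L i τ p < N)
    (hirr : ∀ i τ, i < n → τ ∈ T → Irr A.Adj τ.1 (L i τ))
    (hdist : ∀ i τ σ, i < n → τ ∈ T → σ ∈ T → τ.1 = σ.1 →
      (∀ p q, p < τ.1 → q < τ.1 → (A.Adj (L i τ p) (L i τ q) ↔ A.Adj (L i σ p) (L i σ q))) → τ = σ)
    (a : ℕ → ℕ) (h0 : a 0 ≤ 1)
    (ha : ∀ n, a (n + 1) ≤ ∑ τ ∈ T, if τ.1 ≤ n + 1 then a (n + 1 - τ.1) else 0) :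
    a n ≤ speed P n := by
  classical
  obtain ⟨W, hW, hc⟩ := words_exist T hT a h0 ha n
  refine hc.trans (speed_ge P A hA W (fun w => cat L w 0) ?_ ?_ ?_)
  -- every element lies in some block
  · have hloc : ∀ w : List (ℕ × Bool), ∀ i0, (∀ τ ∈ w, τ ∈ T) → i0 + tot w ≤ n → ∀ p, p < tot w →
        ∃ j τ q, i0 ≤ j ∧ j < n ∧ τ ∈ T ∧ q < τ.1 ∧ cat L w i0 p = L j τ q := by
      intro w
      induction w with
      | nil => intro i0 _ _ p hp; simp [tot] at hp
      | cons τ w ih =>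
        intro i0 hw hn p hp
        have h1 := hT τ (hw τ (by simp))
        simp only [tot] at hn hp
        simp only [cat]
        split_ifs with h
        · exact ⟨i0, τ, p, le_rfl, by omega, hw τ (by simp), h, rfl⟩
        · obtain ⟨j, σ, q, h2, h3, h4, h5, h6⟩ := ih (i0 + 1)
            (fun σ hσ => hw σ (List.mem_cons_of_mem _ hσ)) (by omega) (p - τ.1) (by omega)
          exact ⟨j, σ, q, by omega, h3, h4, h5, h6⟩
    have : ∀ w : List (ℕ × Bool), ∀ i0, (∀ τ ∈ w, τ ∈ T) → i0 + tot w ≤ n → ∀ p q, p < q →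
        q < tot w → cat L w i0 p < cat L w i0 q := by
      intro w
      induction w with
      | nil => intro i0 _ _ p q _ hq; simp [tot] at hq
      | cons τ w ih =>
        intro i0 hw hn p q hpq hq
        have hτ := hw τ (by simp)
        have h1 := hT τ hτ
        have hw' : ∀ σ ∈ w, σ ∈ T := fun σ hσ => hw σ (List.mem_cons_of_mem _ hσ)
        simp only [tot] at hn hq
        simp only [cat]
        split_ifs with h h' h'
        · exact hmono _ _ _ _ (by omega) hτ hpq h'
        · obtain ⟨j, σ, r, h2, h3, h4, h5, h6⟩ := hloc w (i0 + 1) hw' (by omega) (q - τ.1) (by omega)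
          rw [h6]
          exact (hcross _ _ _ _ _ _ (by omega) h3 hτ h4 h h5).1
        · omega
        · exact ih _ hw' (by omega) _ _ (by omega) (by omega)
    intro w hw i j hij hj
    exact this w 0 (hW w hw).1 (by have := (hW w hw).2; omega) i j hij (by have := (hW w hw).2; omega)
  · have hloc : ∀ w : List (ℕ × Bool), ∀ i0, (∀ τ ∈ w, τ ∈ T) → i0 + tot w ≤ n → ∀ p, p < tot w →
        cat L w i0 p < N := by
      intro w
      induction w with
      | nil => intro i0 _ _ p hp; simp [tot] at hp
      | cons τ w ih =>
        intro i0 hw hn p hp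
        have h1 := hT τ (hw τ (by simp))
        simp only [tot] at hn hp
        simp only [cat]
        split_ifs with h
        · exact hN _ _ _ (by omega) (hw τ (by simp)) h
        · exact ih (i0 + 1) (fun σ hσ => hw σ (List.mem_cons_of_mem _ hσ)) (by omega) _ (by omega)
    intro w hw i hi
    exact hloc w 0 (hW w hw).1 (by have := (hW w hw).2; omega) i (by have := (hW w hw).2; omega)
  · have hloc : ∀ w : List (ℕ × Bool), ∀ i0, (∀ τ ∈ w, τ ∈ T) → i0 + tot w ≤ n → ∀ p, p < tot w →
        ∃ j τ q, i0 ≤ j ∧ j < n ∧ τ ∈ T ∧ q < τ.1 ∧ cat L w i0 p = L j τ q := by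
      intro w
      induction w with
      | nil => intro i0 _ _ p hp; simp [tot] at hp
      | cons τ w ih =>
        intro i0 hw hn p hp
        have h1 := hT τ (hw τ (by simp))
        simp only [tot] at hn hp
        simp only [cat]
        split_ifs with h
        · exact ⟨i0, τ, p, le_rfl, by omega, hw τ (by simp), h, rfl⟩
        · obtain ⟨j, σ, q, h2, h3, h4, h5, h6⟩ := ih (i0 + 1)
            (fun σ hσ => hw σ (List.mem_cons_of_mem _ hσ)) (by omega) (p - τ.1) (by omega)
          exact ⟨j, σ, q, by omega, h3, h4, h5, h6⟩
    -- first blocks cannot have different sizes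
    have hsz : ∀ (w w' : List (ℕ × Bool)) (τ σ : ℕ × Bool) (i0 : ℕ), (∀ ρ ∈ τ :: w, ρ ∈ T) →
        (∀ ρ ∈ σ :: w', ρ ∈ T) → tot (τ :: w) = tot (σ :: w') → i0 + tot (τ :: w) ≤ n →
        (∀ p q, p < tot (τ :: w) → q < tot (τ :: w) →
          (A.Adj (cat L (τ :: w) i0 p) (cat L (τ :: w) i0 q) ↔
           A.Adj (cat L (σ :: w') i0 p) (cat L (σ :: w') i0 q))) → ¬ τ.1 < σ.1 := by
      intro w w' τ σ i0 hw hw' htot hn h hlt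
      have hτ := hw τ (by simp)
      have hσ := hw' σ (by simp)
      have h1 := hT τ hτ
      simp only [tot] at htot hn h
      obtain ⟨i, hi, j, hj, hj', hadj⟩ := hirr i0 σ (by omega) hσ τ.1 h1 hlt
      have h2 := (h i j (by omega) (by omega)).2 (by
        simp only [cat]
        rw [if_pos (by omega), if_pos hj']; exact hadj)
      simp only [cat] at h2
      rw [if_pos hi, if_neg (by omega)] at h2
      obtain ⟨k, ρ, r, h3, h4, h5, h6, h7⟩ := hloc w (i0 + 1)
        (fun σ hσ => hw σ (List.mem_cons_of_mem _ hσ)) (by omega) (j - τ.1) (by omega)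
      rw [h7] at h2
      exact (hcross _ _ _ _ _ _ (by omega) h4 hτ h5 hi h6).2 h2
    have : ∀ w w' : List (ℕ × Bool), ∀ i0, (∀ ρ ∈ w, ρ ∈ T) → (∀ ρ ∈ w', ρ ∈ T) →
        tot w = tot w' → i0 + tot w ≤ n →
        (∀ p q, p < tot w → q < tot w →
          (A.Adj (cat L w i0 p) (cat L w i0 q) ↔ A.Adj (cat L w' i0 p) (cat L w' i0 q))) →
        w = w' := by
      intro w
      induction w with
      | nil =>
        intro w' i0 _ hw' ht _ _
        rcases w' with _ | ⟨σ, w'⟩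
        · rfl
        · have := hT σ (hw' σ (by simp))
          simp only [tot] at ht; omega
      | cons τ w ih =>
        intro w' i0 hw hw' ht hn h
        rcases w' with _ | ⟨σ, w'⟩
        · have := hT τ (hw τ (by simp))
          simp only [tot] at ht; omega
        have h1 := hsz w w' τ σ i0 hw hw' ht hn h
        have h2 := hsz w' w σ τ i0 hw' hw ht.symm (by omega) (by
          intro p q hp hq
          exact (h p q (by omega) (by omega)).symm)
        have hs : τ.1 = σ.1 := by omega
        have h3 := hT τ (hw τ (by simp))
        simp only [tot] at ht hn h
        have hτσ : τ = σ := by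
          refine hdist i0 τ σ (by omega) (hw τ (by simp)) (hw' σ (by simp)) hs ?_
          intro p q hp hq
          have := h p q (by omega) (by omega)
          simp only [cat] at this
          rwa [if_pos hp, if_pos hq, if_pos (by omega), if_pos (by omega)] at this
        subst hτσ
        congr 1
        refine ih w' (i0 + 1) (fun σ hσ => hw σ (List.mem_cons_of_mem _ hσ))
          (fun σ hσ => hw' σ (List.mem_cons_of_mem _ hσ)) (by omega) (by omega) ?_
        intro p q hp hq
        have := h (τ.1 + p) (τ.1 + q) (by omega) (by omega)
        simp only [cat] at this
        rw [if_neg (by omega), if_neg (by omega), if_neg (by omega), if_neg (by omega)] at this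
        simpa using this
    intro w hw w' hw' h
    obtain ⟨a1, a2⟩ := hW w hw
    obtain ⟨b1, b2⟩ := hW w' hw'
    refine this w w' 0 a1 b1 (by omega) (by omega) ?_
    intro p q hp hq
    exact h p q (by omega) (by omega)

/-- Irreducible graphs have irreducible induced subgraphs of one size less. -/
lemma irr_del (A : ℕ → ℕ → Prop) (m : ℕ) (hm : 1 ≤ m) (S : ℕ → ℕ) (h : Irr A (m + 1) S) :
    ∃ d, d ≤ m ∧ Irr A m (fun i => if i < d then S i else S (i + 1)) := by
  by_cases h0 : Irr A m (fun i => S (i + 1))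
  · exact ⟨0, by omega, by simpa using h0⟩
  · unfold Irr at h0
    push Not at h0
    obtain ⟨g, hg0, hgm, hg⟩ := h0
    -- gap g+1 in S is crossed only from vertex 0
    refine ⟨g, by omega, ?_⟩
    intro g' hg'0 hg'm
    obtain ⟨i, hi, j, hj, hj', hadj⟩ := h (g + 1) (by omega) (by omega)
    have hi0 : i = 0 := by
      by_contra hne
      have := hg (i - 1) (by omega) (j - 1) (by omega) (by omega)
      rw [show i - 1 + 1 = i by omega, show j - 1 + 1 = j by omega] at this
      exact this hadj
    subst hi0
    by_cases hgg : g' ≤ j - 1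
    · refine ⟨0, hg'0, j - 1, hgg, by omega, ?_⟩
      simp only
      rw [if_pos (by omega), if_neg (by omega), show j - 1 + 1 = j by omega]
      exact hadj
    · -- gap beyond j
      obtain ⟨i, hi, k, hk, hk', hadj'⟩ := h (g' + 1) (by omega) (by omega)
      by_cases hig : i < g
      · refine ⟨i, by omega, k - 1, by omega, by omega, ?_⟩
        simp only
        rw [if_pos hig, if_neg (by omega), show k - 1 + 1 = k by omega]
        exact hadj'
      · by_cases hie : i = g
        · exfalso
          have := hg (i - 1) (by omega) (k - 1) (by omega) (by omega)
          rw [show i - 1 + 1 = i by omega, show k - 1 + 1 = k by omega] at this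
          exact this hadj'
        · refine ⟨i - 1, by omega, k - 1, by omega, by omega, ?_⟩
          simp only
          rw [if_neg (by omega), if_neg (by omega), show k - 1 + 1 = k by omega,
            show i - 1 + 1 = i by omega]
          exact hadj'

lemma irr_sub (A : ℕ → ℕ → Prop) (m r : ℕ) (hr : 1 ≤ r) (hrm : r ≤ m) (S : ℕ → ℕ)
    (h : Irr A m S) :
    ∃ φ : ℕ → ℕ, StrictMono φ ∧ (∀ i < r, φ i < m) ∧ Irr A r (fun i => S (φ i)) := by
  induction m, hrm using Nat.le_induction generalizing S with
  | base => exact ⟨id, strictMono_id, fun i hi => hi, h⟩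
  | succ m hm ih =>
    obtain ⟨d, hd, h'⟩ := irr_del A m (by omega) S h
    obtain ⟨φ, h1, h2, h3⟩ := ih _ h'
    refine ⟨fun i => if φ i < d then φ i else φ i + 1, ?_, ?_, ?_⟩
    · intro i j hij
      have := h1 hij
      dsimp only
      split_ifs <;> omega
    · intro i hi
      have := h2 i hi
      dsimp only
      split_ifs <;> omega
    · convert h3 using 2 with i
      dsimp only
      split_ifs <;> rfl

lemma genFib_rec (k n : ℕ) : genFib k (n + 1) ≤ ∑ τ ∈ (Finset.range k).image (fun i => (i + 1, false)),
    if τ.1 ≤ n + 1 then genFib k (n + 1 - τ.1) else 0 := by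
  rw [Finset.sum_image (by intro a _ b _ h; simpa using h), genFib]
  apply Finset.sum_le_sum
  intro i _
  simp only [add_le_add_iff_right, Nat.add_sub_add_right]
  exact le_rfl

/-- the speed `2^(n-1)` with value 1 at 0 -/
def pw : ℕ → ℕ
  | 0 => 1
  | n + 1 => 2 ^ n

lemma pw_two (n : ℕ) : pw (n + 1) ≤ 2 * pw n := by
  rcases n with _ | n
  · simp [pw]
  · simp [pw, pow_succ]; omega

lemma pw_all (n : ℕ) : ∑ i ∈ Finset.range (n + 1), pw (n - i) = pw (n + 1) := by
  have h : ∀ n, ∑ i ∈ Finset.range (n + 1), pw i = pw (n + 1) := by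
    intro n
    induction n with
    | zero => simp [pw]
    | succ n ih => rw [Finset.sum_range_succ, ih]; simp [pw, pow_succ]; omega
  rw [← h n, ← Finset.sum_range_reflect (fun i => pw i)]
  apply Finset.sum_congr rfl
  intro i _
  congr 1

lemma pw_sum (n r : ℕ) (hr : 1 ≤ r) : pw (n + 1) ≤
    (∑ i ∈ Finset.range r, if i + 1 ≤ n + 1 then pw (n + 1 - (i + 1)) else 0) +
      if r ≤ n + 1 then pw (n + 1 - r) else 0 := by
  induction r, hr using Nat.le_induction with
  | base => have := pw_two n; simp; omega
  | succ r hr ih =>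
    by_cases h : r + 1 ≤ n + 1
    · refine ih.trans ?_
      rw [Finset.sum_range_succ]
      have := pw_two (n - r)
      rw [if_pos (by omega), if_pos (by omega)]
      rw [show n - r + 1 = n + 1 - r by omega] at this
      rw [show n + 1 - (r + 1) = n - r by omega]
      omega
    · rw [if_neg h, ← pw_all n]
      refine le_trans (le_of_eq ?_) ((Finset.sum_le_sum_of_subset
        (Finset.range_subset_range.mpr (show n + 1 ≤ r + 1 by omega))).trans (Nat.le_add_right _ _))
      apply Finset.sum_congr rfl
      intro i hi
      have := Finset.mem_range.mp hi
      rw [if_pos (by omega)]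
      congr 1; omega

/-- many irreducible blocks of size `r` -/
lemma sumA (P : HerProp) {n N r : ℕ} (A : SimpleGraph ℕ)
    (hA : A.comap (fun i : Fin N => (i : ℕ)) ∈ P.mem N) (V : ℕ → Set ℕ)
    (hV : ∀ i j, i < j → j < n → ∀ u ∈ V i, ∀ v ∈ V j, u < v ∧ ¬ A.Adj u v)
    (S : ℕ → ℕ → ℕ) (hS : ∀ i < n, (∀ p q, p < q → q < r → S i p < S i q) ∧
      (∀ p < r, S i p ∈ V i ∧ S i p < N) ∧ Irr A.Adj r (S i)) :
    genFib r n ≤ speed P n := by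
  classical
  have key : ∀ i s, ∃ φ : ℕ → ℕ, i < n → 1 ≤ s → s ≤ r → StrictMono φ ∧ (∀ i < s, φ i < r) ∧
      Irr A.Adj s (fun p => S i (φ p)) := by
    intro i s
    by_cases h : i < n ∧ 1 ≤ s ∧ s ≤ r
    · obtain ⟨φ, h'⟩ := irr_sub A.Adj r s h.2.1 h.2.2 (S i) (hS i h.1).2.2
      exact ⟨φ, fun _ _ _ => h'⟩
    · exact ⟨id, fun h1 h2 h3 => absurd ⟨h1, h2, h3⟩ h⟩
  choose φ hφ using key
  have hT : ∀ τ ∈ (Finset.range r).image (fun i => (i + 1, false)), 1 ≤ τ.1 ∧ τ.1 ≤ r ∧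
      τ.2 = false := by
    intro τ hτ
    obtain ⟨i, hi, rfl⟩ := Finset.mem_image.mp hτ
    have := Finset.mem_range.mp hi
    exact ⟨by simp, by simp; omega, rfl⟩
  refine sum_speed P A hA _ (fun τ hτ => (hT τ hτ).1) (fun i τ p => S i (φ i τ.1 p))
    ?_ ?_ ?_ ?_ ?_ (genFib r) (by rw [genFib]) (genFib_rec r)
  · intro i τ p q hi hτ hpq hq
    obtain ⟨h1, h2, h3⟩ := hT τ hτ
    obtain ⟨a, b, c⟩ := hφ i τ.1 hi h1 h2
    exact (hS i hi).1 _ _ (a hpq) (b q hq)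
  · intro i j τ σ p q hij hj hτ hσ hp hq
    obtain ⟨h1, h2, h3⟩ := hT τ hτ
    obtain ⟨a, b, c⟩ := hφ i τ.1 (by omega) h1 h2
    obtain ⟨h1', h2', h3'⟩ := hT σ hσ
    obtain ⟨a', b', c'⟩ := hφ j σ.1 (by omega) h1' h2'
    exact hV i j hij hj _ ((hS i (by omega)).2.1 _ (b p hp)).1 _ ((hS j hj).2.1 _ (b' q hq)).1
  · intro i τ p hi hτ hp
    obtain ⟨h1, h2, h3⟩ := hT τ hτ
    obtain ⟨a, b, c⟩ := hφ i τ.1 (by omega) h1 h2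
    exact ((hS i (by omega)).2.1 _ (b p hp)).2
  · intro i τ hi hτ
    obtain ⟨h1, h2, h3⟩ := hT τ hτ
    exact (hφ i τ.1 (by omega) h1 h2).2.2
  · intro i τ σ _ hτ hσ h _
    exact Prod.ext h ((hT τ hτ).2.2.trans (hT σ hσ).2.2.symm)

/-- many pairs of different irreducible blocks of size `r` -/
lemma sumB (P : HerProp) {n N r : ℕ} (hr : 1 ≤ r) (A : SimpleGraph ℕ)
    (hA : A.comap (fun i : Fin N => (i : ℕ)) ∈ P.mem N) (V : ℕ → Set ℕ)
    (hV : ∀ i j, i < j → j < n → ∀ u ∈ V i, ∀ v ∈ V j, u < v ∧ ¬ A.Adj u v)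
    (S S' : ℕ → ℕ → ℕ) (hS : ∀ i < n, (∀ p q, p < q → q < r → S i p < S i q) ∧
      (∀ p < r, S i p ∈ V i ∧ S i p < N) ∧ Irr A.Adj r (S i))
    (hS' : ∀ i < n, (∀ p q, p < q → q < r → S' i p < S' i q) ∧
      (∀ p < r, S' i p ∈ V i ∧ S' i p < N) ∧ Irr A.Adj r (S' i))
    (hne : ∀ i < n, ∃ p < r, ∃ q < r, ¬ (A.Adj (S i p) (S i q) ↔ A.Adj (S' i p) (S' i q))) :
    pw n ≤ speed P n := by
  classical
  have key : ∀ i s, ∃ φ : ℕ → ℕ, i < n → 1 ≤ s → s ≤ r → StrictMono φ ∧ (∀ i < s, φ i < r) ∧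
      Irr A.Adj s (fun p => S i (φ p)) ∧ (s = r → φ = id) := by
    intro i s
    by_cases h : i < n ∧ 1 ≤ s ∧ s ≤ r
    · by_cases hsr : s = r
      · subst hsr
        exact ⟨id, fun _ _ _ => ⟨strictMono_id, fun i hi => hi, (hS i h.1).2.2, fun _ => rfl⟩⟩
      · obtain ⟨φ, h1, h2, h3⟩ := irr_sub A.Adj r s h.2.1 h.2.2 (S i) (hS i h.1).2.2
        exact ⟨φ, fun _ _ _ => ⟨h1, h2, h3, fun h => absurd h hsr⟩⟩
    · exact ⟨id, fun h1 h2 h3 => absurd ⟨h1, h2, h3⟩ h⟩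
  choose φ hφ using key
  set T0 : Finset (ℕ × Bool) := (Finset.range r).image (fun i => (i + 1, false)) with hT0
  have hT : ∀ τ ∈ insert (r, true) T0, 1 ≤ τ.1 ∧ τ.1 ≤ r ∧ (τ.2 = true → τ.1 = r) := by
    intro τ hτ
    rcases Finset.mem_insert.mp hτ with rfl | hτ
    · exact ⟨hr, le_rfl, fun _ => rfl⟩
    obtain ⟨i, hi, rfl⟩ := Finset.mem_image.mp hτ
    have := Finset.mem_range.mp hi
    exact ⟨by simp, by simp; omega, by simp⟩
  let L : ℕ → ℕ × Bool → ℕ → ℕ := fun i τ p => if τ.2 then S' i p else S i (φ i τ.1 p)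
  have hL : ∀ i < n, ∀ τ ∈ insert (r, true) T0, (∀ p q, p < q → q < τ.1 → L i τ p < L i τ q) ∧
      (∀ p < τ.1, L i τ p ∈ V i ∧ L i τ p < N) ∧ Irr A.Adj τ.1 (L i τ) := by
    intro i hi τ hτ
    obtain ⟨h1, h2, h3⟩ := hT τ hτ
    obtain ⟨s, b⟩ := τ
    cases b
    · obtain ⟨a, b, c, d⟩ := hφ i s hi h1 h2
      refine ⟨?_, ?_, ?_⟩
      · intro p q hpq hq
        exact (hS i hi).1 _ _ (a hpq) (b q hq)
      · intro p hp
        exact (hS i hi).2.1 _ (b p hp)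
      · exact c
    · have : s = r := h3 rfl
      subst this
      exact hS' i hi
  refine sum_speed P A hA _ (fun τ hτ => (hT τ hτ).1) L ?_ ?_ ?_ ?_ ?_ pw (by simp [pw]) ?_
  · intro i τ p q hi hτ hpq hq
    exact (hL i hi τ hτ).1 p q hpq hq
  · intro i j τ σ p q hij hj hτ hσ hp hq
    exact hV i j hij hj _ ((hL i (by omega) τ hτ).2.1 p hp).1 _ ((hL j hj σ hσ).2.1 q hq).1
  · intro i τ p hi hτ hp
    exact ((hL i (by omega) τ hτ).2.1 p hp).2
  · intro i τ hi hτ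
    exact (hL i hi τ hτ).2.2
  · -- distinct types, distinct patterns
    intro i τ σ hi hτ hσ h hpat
    obtain ⟨a1, a2, a3⟩ := hT τ hτ
    obtain ⟨b1, b2, b3⟩ := hT σ hσ
    obtain ⟨p, hp, q, hq, hpq⟩ := hne i hi
    obtain ⟨s, b⟩ := τ
    obtain ⟨s', b'⟩ := σ
    dsimp only at h
    subst h
    cases b <;> cases b'
    · rfl
    · exfalso
      have : s = r := b3 rfl
      subst this
      have hid := (hφ i s hi a1 a2).2.2.2 rfl
      apply hpq
      have := hpat p q hp hq
      simp only [L, hid] at this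
      simpa using this
    · exfalso
      have : s = r := a3 rfl
      subst this
      have hid := (hφ i s hi a1 a2).2.2.2 rfl
      apply hpq
      have := hpat p q hp hq
      simp only [L, hid] at this
      simpa using this.symm
    · rfl
  · intro m
    rw [Finset.sum_insert (by simp [T0]), hT0,
      Finset.sum_image (by intro a _ b _ h; simpa using h)]
    have := pw_sum m r hr
    rw [add_comm] at this ⊢
    simp only [add_comm] at this ⊢
    exact this

lemma pw_eq {n : ℕ} (hn : 1 ≤ n) : pw n = 2 ^ (n - 1) := by
  obtain ⟨m, rfl⟩ : ∃ m, n = m + 1 := ⟨n - 1, by omega⟩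
  rfl

end OG

namespace OG

/-- the running hypothesis -/
def Slow (P : HerProp) (n ℓ : ℕ) : Prop := 1 ≤ n ∧ 1 ≤ ℓ ∧ speed P n < genFib (ℓ + 1) n

lemma Slow.cpl {P : HerProp} {n ℓ : ℕ} (h : Slow P n ℓ) : Slow (cpl P) n ℓ :=
  ⟨h.1, h.2.1, by rw [speed_cpl]; exact h.2.2⟩

lemma Slow.rvs {P : HerProp} {n ℓ : ℕ} (h : Slow P n ℓ) : Slow (rvs P) n ℓ :=
  ⟨h.1, h.2.1, by rw [speed_rvs]; exact h.2.2⟩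

lemma Slow.two {P : HerProp} {n ℓ : ℕ} (h : Slow P n ℓ) (h' : 2 ^ (n - 1) ≤ speed P n) : False := by
  obtain ⟨m, rfl⟩ : ∃ m, n = m + 1 := ⟨n - 1, by have := h.1; omega⟩
  have := genFib_le_two_pow (ℓ + 1) m
  have := h.2.2
  simp at h'
  omega

lemma Slow.fib {P : HerProp} {n ℓ : ℕ} (h : Slow P n ℓ) (h' : genFib (ℓ + 1) n ≤ speed P n) :
    False := by
  have := h.2.2
  omega

/-- edges from first to last vertex: irreducible -/
lemma caseD {P : HerProp} {n ℓ N : ℕ} (hs : Slow P n ℓ) (A : SimpleGraph ℕ)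
    (hA : A.comap (fun i : Fin N => (i : ℕ)) ∈ P.mem N) (S : ℕ → ℕ → ℕ)
    (hS : ∀ i < n, (∀ p q, p < q → q ≤ ℓ → S i p < S i q) ∧ A.Adj (S i 0) (S i ℓ) ∧ S i ℓ < N)
    (hV : ∀ i j, i < j → j < n → ∀ p q, p ≤ ℓ → q ≤ ℓ → S i p < S j q ∧ ¬ A.Adj (S i p) (S j q)) :
    False := by
  have hl := hs.2.1
  refine hs.fib (sumA P A hA (fun i => {u | ∃ p ≤ ℓ, S i p = u}) ?_ S ?_)
  · rintro i j hij hj u ⟨p, hp, rfl⟩ v ⟨q, hq, rfl⟩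
    exact hV i j hij hj p q hp hq
  · intro i hi
    obtain ⟨h1, h2, h3⟩ := hS i hi
    refine ⟨fun p q hpq hq => h1 p q hpq (by omega), ?_, ?_⟩
    · intro p hp
      refine ⟨⟨p, by omega, rfl⟩, ?_⟩
      rcases Nat.lt_or_ge p ℓ with h | h
      · exact (h1 p ℓ h le_rfl).trans h3
      · have : p = ℓ := by omega
        rw [this]; exact h3
    · intro g hg0 hg
      exact ⟨0, hg0, ℓ, by omega, by omega, h2⟩

/-- type 1 with a choice of either orientation -/
lemma type1' {P : HerProp} {n ℓ N : ℕ} (hs : Slow P n ℓ) (A : SimpleGraph ℕ)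
    (hA : A.comap (fun i : Fin N => (i : ℕ)) ∈ P.mem N)
    (y : ℕ) (X Y : ℕ → ℕ) (F F' : Prop) (hFF : ¬ (F ↔ F'))
    (hX : ∀ i j, i < j → j < n - 1 → X i < X j ∧ X i < Y j ∧ Y i < X j ∧ Y i < Y j)
    (hN : ∀ i, i < n - 1 → X i < N ∧ Y i < N) (hy : y < N)
    (hside : (∀ i, i < n - 1 → y < X i ∧ y < Y i) ∨ (∀ i, i < n - 1 → X i < y ∧ Y i < y))
    (hadj : ∀ i, i < n - 1 → (A.Adj y (X i) ↔ F) ∧ (A.Adj y (Y i) ↔ F')) : False := by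
  have key : ∀ (X Y : ℕ → ℕ) (F F' : Prop), ¬ (F ↔ F') → 
    (∀ i j, i < j → j < n - 1 → X i < X j ∧ X i < Y j ∧ Y i < X j ∧ Y i < Y j) →
    (∀ i, i < n - 1 → X i < N ∧ Y i < N) → 
    ((∀ i, i < n - 1 → y < X i ∧ y < Y i) ∨ (∀ i, i < n - 1 → X i < y ∧ Y i < y)) →
    (∀ i, i < n - 1 → (A.Adj y (X i) ↔ F) ∧ (A.Adj y (Y i) ↔ F')) → F → False := by
    intro X Y F F' hFF hX hN hside hadj hF
    refine hs.two (type1 P A hA hs.1 y (fun a => if a then X else Y) ?_ ?_ hy ?_ ?_)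
    · intro a b i j hij hj
      have := hX i j hij hj
      cases a <;> cases b <;> simp [this]
    · intro a i hi
      have := hN i hi
      cases a <;> simp [this]
    · rcases hside with h | h
      · left; intro a i hi
        have := h i hi
        cases a <;> simp [this]
      · right; intro a i hi
        have := h i hi
        cases a <;> simp [this]
    · intro i hi
      have := hadj i hi
      have hF' : ¬ F' := fun h => hFF ⟨fun _ => h, fun _ => hF⟩
      simp [this, hF, hF']
  by_cases hF : F
  · exact key X Y F F' hFF hX hN hside hadj hF
  · have hF' : F' := by tauto
    refine key Y X F' F (by tauto) ?_ ?_ ?_ ?_ hF'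
    · intro i j hij hj; have := hX i j hij hj; tauto
    · intro i hi; have := hN i hi; tauto
    · rcases hside with h | h
      · left; intro i hi; exact (h i hi).symm
      · right; intro i hi; exact (h i hi).symm
    · intro i hi; exact (hadj i hi).symm

lemma core {P : HerProp} {n ℓ N : ℕ} (hs : Slow P n ℓ) (A : SimpleGraph ℕ)
    (hA : A.comap (fun i : Fin N => (i : ℕ)) ∈ P.mem N) (x : ℕ → ℕ) (V : ℕ → ℕ → ℕ)
    (hmono : ∀ i < n + 2, ∀ p q, p < q → 2 ≤ q → q ≤ ℓ + 1 → V i p < V i q)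
    (hVx : ∀ i < n + 2, ∀ p ≤ ℓ + 1, x i ≤ V i p)
    (hXx : ∀ i < n + 2, V i 0 ≤ x i + 1 ∧ V i 1 ≤ x i + 1)
    (hx : ∀ i j, i < j → j < n + 2 → x i + 1 < x j)
    (hN : ∀ i < n + 2, V i (ℓ + 1) < N)
    (hadj : ∀ i < n + 2, ¬ A.Adj (V i 0) (V i (ℓ + 1)) ∧ A.Adj (V i 1) (V i (ℓ + 1)))
    (D Lt Eq : Prop) (F : ℕ → ℕ → Prop)
    (hD : ∀ i j, i < j → j < n + 2 → (V i (ℓ + 1) < x j ↔ D))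
    (hLt : ∀ i j, i < j → j < n + 2 → (V i (ℓ + 1) < V j (ℓ + 1) ↔ Lt))
    (hEq : ∀ i j, i < j → j < n + 2 → (V i (ℓ + 1) = V j (ℓ + 1) ↔ Eq))
    (hF : ∀ i j, i < j → j < n + 2 → ∀ p q, p ≤ ℓ + 1 → q ≤ ℓ + 1 →
      (A.Adj (V i p) (V j q) ↔ F p q)) : False := by
  have hl := hs.2.1
  have hVN : ∀ i < n + 2, ∀ p ≤ ℓ + 1, V i p < N := by
    intro i hi p hp
    rcases Nat.lt_or_ge p (ℓ + 1) with h | h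
    · exact (hmono i hi p (ℓ + 1) h (by omega) le_rfl).trans (hN i hi)
    · have : p = ℓ + 1 := by omega
      rw [this]; exact hN i hi
  have hVv : ∀ i < n + 2, ∀ p ≤ ℓ + 1, V i p ≤ V i (ℓ + 1) := by
    intro i hi p hp
    rcases Nat.lt_or_ge p (ℓ + 1) with h | h
    · exact (hmono i hi p (ℓ + 1) h (by omega) le_rfl).le
    · have : p = ℓ + 1 := by omega
      rw [this]
  by_cases hDD : D
  · have hlt : ∀ i j, i < j → j < n + 2 → ∀ p q, p ≤ ℓ + 1 → q ≤ ℓ + 1 → V i p < V j q := by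
      intro i j hij hj p q hp hq
      have h1 := (hD i j hij hj).2 hDD
      have h2 := hVv i (by omega) p hp
      have h3 := hVx j hj q hq
      omega
    by_cases h1 : ∃ p p' q, p ≤ ℓ + 1 ∧ p' ≤ ℓ + 1 ∧ q ≤ ℓ + 1 ∧ ¬ (F p q ↔ F p' q)
    · obtain ⟨p, p', q, hp, hp', hq, hne⟩ := h1
      refine type1' hs A hA (V n q) (fun i => V i p) (fun i => V i p') _ _ hne ?_ ?_ ?_ ?_ ?_
      · intro i j hij hj
        exact ⟨hlt _ _ hij (by omega) _ _ hp hp, hlt _ _ hij (by omega) _ _ hp hp',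
          hlt _ _ hij (by omega) _ _ hp' hp, hlt _ _ hij (by omega) _ _ hp' hp'⟩
      · intro i hi; exact ⟨hVN _ (by omega) _ hp, hVN _ (by omega) _ hp'⟩
      · exact hVN _ (by omega) _ hq
      · right; intro i hi
        exact ⟨hlt _ _ (by omega) (by omega) _ _ hp hq, hlt _ _ (by omega) (by omega) _ _ hp' hq⟩
      · intro i hi
        rw [A.adj_comm, A.adj_comm (V n q)]
        exact ⟨hF _ _ (by omega) (by omega) _ _ hp hq, hF _ _ (by omega) (by omega) _ _ hp' hq⟩
    by_cases h2 : ∃ p q q', p ≤ ℓ + 1 ∧ q ≤ ℓ + 1 ∧ q' ≤ ℓ + 1 ∧ ¬ (F p q ↔ F p q')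
    · obtain ⟨p, q, q', hp, hq, hq', hne⟩ := h2
      refine type1' hs A hA (V 0 p) (fun i => V (i + 1) q) (fun i => V (i + 1) q') _ _ hne ?_ ?_ ?_ ?_ ?_
      · intro i j hij hj
        exact ⟨hlt _ _ (by omega) (by omega) _ _ hq hq, hlt _ _ (by omega) (by omega) _ _ hq hq',
          hlt _ _ (by omega) (by omega) _ _ hq' hq, hlt _ _ (by omega) (by omega) _ _ hq' hq'⟩
      · intro i hi; exact ⟨hVN _ (by omega) _ hq, hVN _ (by omega) _ hq'⟩
      · exact hVN _ (by omega) _ hp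
      · left; intro i hi
        exact ⟨hlt _ _ (by omega) (by omega) _ _ hp hq, hlt _ _ (by omega) (by omega) _ _ hp hq'⟩
      · intro i hi
        exact ⟨hF _ _ (by omega) (by omega) _ _ hp hq, hF _ _ (by omega) (by omega) _ _ hp hq'⟩
    push Not at h1 h2
    have hconst : ∀ p q, p ≤ ℓ + 1 → q ≤ ℓ + 1 → (F p q ↔ F 0 0) := by
      intro p q hp hq
      exact (h1 p 0 q hp (by omega) hq).trans (h2 0 q 0 (by omega) hq (by omega))
    let S : ℕ → ℕ → ℕ → ℕ := fun a i p => if p = 0 then V i a else V i (p + 1)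
    have hSm : ∀ a ≤ 1, ∀ i < n + 2, ∀ p q, p < q → q ≤ ℓ → S a i p < S a i q := by
      intro a ha i hi p q hpq hq
      simp only [S]
      rw [if_neg (by omega : q ≠ 0)]
      split_ifs with h
      · exact hmono i hi _ _ (by omega) (by omega) (by omega)
      · exact hmono i hi _ _ (by omega) (by omega) (by omega)
    have hSV : ∀ a ≤ 1, ∀ i p, p ≤ ℓ → ∃ p' ≤ ℓ + 1, S a i p = V i p' := by
      intro a ha i p hp
      simp only [S]
      split_ifs with h
      · exact ⟨a, by omega, rfl⟩
      · exact ⟨p + 1, by omega, rfl⟩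
    by_cases hc : F 0 0
    · refine caseD hs.cpl Aᶜ (mem_cpl P hA) (S 0) ?_ ?_
      · intro i hi
        refine ⟨hSm 0 (by omega) i (by omega), ?_, ?_⟩
        · have := hSm 0 (by omega) i (by omega) 0 ℓ (by omega) le_rfl
          rw [SimpleGraph.compl_adj]
          refine ⟨by omega, ?_⟩
          simp only [S]
          rw [if_neg (by omega : ℓ ≠ 0)]
          exact (hadj i (by omega)).1
        · simp only [S]
          rw [if_neg (by omega : ℓ ≠ 0)]
          exact hN i (by omega)
      · intro i j hij hj p q hp hq
        obtain ⟨p', hp', e1⟩ := hSV 0 (by omega) i p hp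
        obtain ⟨q', hq', e2⟩ := hSV 0 (by omega) j q hq
        rw [e1, e2]
        refine ⟨hlt _ _ hij (by omega) _ _ hp' hq', ?_⟩
        rw [SimpleGraph.compl_adj]
        intro h
        exact h.2 ((hF _ _ hij (by omega) _ _ hp' hq').2 ((hconst _ _ hp' hq').2 hc))
    · refine caseD hs A hA (S 1) ?_ ?_
      · intro i hi
        refine ⟨hSm 1 (by omega) i (by omega), ?_, ?_⟩
        · simp only [S]
          rw [if_neg (by omega : ℓ ≠ 0)]
          exact (hadj i (by omega)).2
        · simp only [S]
          rw [if_neg (by omega : ℓ ≠ 0)]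
          exact hN i (by omega)
      · intro i j hij hj p q hp hq
        obtain ⟨p', hp', e1⟩ := hSV 1 (by omega) i p hp
        obtain ⟨q', hq', e2⟩ := hSV 1 (by omega) j q hq
        rw [e1, e2]
        refine ⟨hlt _ _ hij (by omega) _ _ hp' hq', ?_⟩
        intro h
        exact hc ((hconst _ _ hp' hq').1 ((hF _ _ hij (by omega) _ _ hp' hq').1 h))
  · have hXX : ∀ a b, a ≤ 1 → b ≤ 1 → ∀ i j, i < j → j < n + 2 → V i a < V j b := by
      intro a b ha hb i j hij hj
      have h1 := hx i j hij hj
      have h2 := hXx i (by omega)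
      have h3 := hVx j hj b (by omega)
      have : a = 0 ∨ a = 1 := by omega
      rcases this with rfl | rfl <;> omega
    have hXv : ∀ a ≤ 1, ∀ i j, i < n + 1 → j < n + 1 → V i a < V j (ℓ + 1) := by
      intro a ha i j hi hj
      have h1 := hx i (n + 1) hi (by omega)
      have h2 := hXx i (by omega)
      have h3 := mt (hD j (n + 1) hj (by omega)).1 hDD
      have : a = 0 ∨ a = 1 := by omega
      rcases this with rfl | rfl <;> omega
    by_cases hE : Eq
    · have hv : ∀ i, i < n + 2 → V i (ℓ + 1) = V 0 (ℓ + 1) := by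
        intro i hi
        rcases Nat.eq_zero_or_pos i with rfl | h
        · rfl
        · exact ((hEq 0 i h hi).2 hE).symm
      refine type1' hs A hA (V 0 (ℓ + 1)) (fun i => V i 0) (fun i => V i 1) False True
        (by simp) ?_ ?_ ?_ ?_ ?_
      · intro i j hij hj
        refine ⟨?_, ?_, ?_, ?_⟩ <;> exact hXX _ _ (by omega) (by omega) _ _ hij (by omega)
      · intro i hi
        exact ⟨hVN _ (by omega) _ (by omega), hVN _ (by omega) _ (by omega)⟩
      · exact hN _ (by omega)
      · right; intro i hi
        exact ⟨hXv _ (by omega) _ _ (by omega) (by omega), hXv _ (by omega) _ _ (by omega) (by omega)⟩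
      · intro i hi
        rw [A.adj_comm, A.adj_comm _ (V i 1), ← hv i (by omega)]
        have := hadj i (by omega)
        simp [this]
    by_cases hne : F (ℓ + 1) 0 ↔ F (ℓ + 1) 1
    swap
    · refine type1' hs A hA (V 0 (ℓ + 1)) (fun i => V (i + 1) 0) (fun i => V (i + 1) 1) _ _
        hne ?_ ?_ ?_ ?_ ?_
      · intro i j hij hj
        refine ⟨?_, ?_, ?_, ?_⟩ <;> exact hXX _ _ (by omega) (by omega) _ _ (by omega) (by omega)
      · intro i hi
        exact ⟨hVN _ (by omega) _ (by omega), hVN _ (by omega) _ (by omega)⟩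
      · exact hN _ (by omega)
      · right; intro i hi
        exact ⟨hXv _ (by omega) _ _ (by omega) (by omega), hXv _ (by omega) _ _ (by omega) (by omega)⟩
      · intro i hi
        exact ⟨hF _ _ (by omega) (by omega) _ _ (by omega) (by omega),
          hF _ _ (by omega) (by omega) _ _ (by omega) (by omega)⟩
    · have hy : (∀ i j, i < j → j < n → V i (ℓ + 1) < V j (ℓ + 1)) ∨
          (∀ i j, i < j → j < n → V j (ℓ + 1) < V i (ℓ + 1)) := by
        by_cases h : Lt
        · left; intro i j hij hj; exact (hLt i j hij (by omega)).2 h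
        · right; intro i j hij hj
          have h1 := mt (hLt i j hij (by omega)).1 h
          have h2 := mt (hEq i j hij (by omega)).1 hE
          omega
      have hvne : ∀ i j, i < j → j < n → V i (ℓ + 1) ≠ V j (ℓ + 1) := by
        intro i j hij hj
        exact mt (hEq i j hij (by omega)).1 hE
      by_cases hc : F (ℓ + 1) (ℓ + 1)
      · refine hs.cpl.two (type2 _ Aᶜ (mem_cpl P hA) hs.1 (fun i => V i (ℓ + 1))
          (fun a i => if a then V i 0 else V i 1) (¬ F (ℓ + 1) 0) ?_ ?_ ?_ hy ?_ ?_ ?_)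
        · intro a b i j hij hj
          cases a <;> cases b <;> exact hXX _ _ (by omega) (by omega) _ _ hij (by omega)
        · intro a i j hi hj
          cases a <;> exact hXv _ (by omega) _ _ (by omega) (by omega)
        · intro i hi; exact hN i (by omega)
        · intro i j hi hj h
          rw [SimpleGraph.compl_adj] at h
          rcases lt_trichotomy i j with h1 | h1 | h1
          · exact h.2 ((hF i j h1 (by omega) _ _ le_rfl le_rfl).2 hc)
          · exact h.1 (by rw [h1])
          · exact h.2 ((hF j i h1 (by omega) _ _ le_rfl le_rfl).2 hc).symm
        · intro i hi
          have h1 := hadj i (by omega)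
          have h2 := hXv 0 (by omega) i i (by omega) (by omega)
          simp only [SimpleGraph.compl_adj, if_true]
          refine ⟨⟨by omega, h1.1⟩, ?_⟩
          intro h
          exact h.2 h1.2
        · intro a i j hij hj
          have h2 : ∀ a ≤ 1, V j a ≠ V i (ℓ + 1) := by
            intro a ha
            have := hXv a ha j i (by omega) (by omega)
            omega
          cases a
          · simp only [SimpleGraph.compl_adj]
            rw [A.adj_comm]
            have := hF i j hij (by omega) (ℓ + 1) 1 le_rfl (by omega)
            have := h2 1 le_rfl
            simp; tauto
          · simp only [SimpleGraph.compl_adj]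
            rw [A.adj_comm]
            have := hF i j hij (by omega) (ℓ + 1) 0 le_rfl (by omega)
            have := h2 0 (by omega)
            simp; tauto
      · refine hs.two (type2 _ A hA hs.1 (fun i => V i (ℓ + 1))
          (fun a i => if a then V i 1 else V i 0) (F (ℓ + 1) 0) ?_ ?_ ?_ hy ?_ ?_ ?_)
        · intro a b i j hij hj
          cases a <;> cases b <;> exact hXX _ _ (by omega) (by omega) _ _ hij (by omega)
        · intro a i j hi hj
          cases a <;> exact hXv _ (by omega) _ _ (by omega) (by omega)
        · intro i hi; exact hN i (by omega)
        · intro i j hi hj h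
          rcases lt_trichotomy i j with h1 | h1 | h1
          · exact hc ((hF i j h1 (by omega) _ _ le_rfl le_rfl).1 h)
          · rw [h1] at h; exact A.loopless.irrefl _ h
          · exact hc ((hF j i h1 (by omega) _ _ le_rfl le_rfl).1 h.symm)
        · intro i hi
          have h1 := hadj i (by omega)
          simpa using h1.symm
        · intro a i j hij hj
          rw [A.adj_comm]
          cases a
          · exact hF i j hij (by omega) (ℓ + 1) 0 le_rfl (by omega)
          · exact (hF i j hij (by omega) (ℓ + 1) 1 le_rfl (by omega)).trans hne.symm

/-- no long sequences of right changes -/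
lemma no_changes {P : HerProp} {n ℓ : ℕ} (hs : Slow P n ℓ) : ∃ K, ∀ N (A : SimpleGraph ℕ),
    A.comap (fun i : Fin N => (i : ℕ)) ∈ P.mem N → ∀ x v : ℕ → ℕ,
    (∀ i < K, v i < N ∧ x i + 1 + ℓ ≤ v i ∧ ¬ (A.Adj (x i) (v i) ↔ A.Adj (x i + 1) (v i))) →
    (∀ i j, i < j → j < K → x i + 1 < x j) → False := by
  classical
  have hl := hs.2.1
  obtain ⟨R, hR⟩ := ramsey (κ := Prop × Prop × Prop × (Fin (ℓ + 2) → Fin (ℓ + 2) → Prop)) (n + 2)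
  refine ⟨R, ?_⟩
  intro N A hA x v h hx
  let V : ℕ → ℕ → ℕ := fun i p =>
    if p = 0 then (if A.Adj (x i) (v i) then x i + 1 else x i)
    else if p = 1 then (if A.Adj (x i) (v i) then x i else x i + 1)
    else if p = ℓ + 1 then v i else x i + p
  obtain ⟨f, ⟨D, Lt, Eq, F⟩, hf, hc⟩ := hR (fun i j =>
    (V i (ℓ + 1) < x j, V i (ℓ + 1) < V j (ℓ + 1), V i (ℓ + 1) = V j (ℓ + 1),
      fun p q => A.Adj (V i p) (V j q)))
  have hVl : ∀ i, V i (ℓ + 1) = v i := by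
    intro i; simp only [V]
    rw [if_neg (by omega), if_neg (by omega), if_pos trivial]
  have hV0 : ∀ i, V i 0 = if A.Adj (x i) (v i) then x i + 1 else x i := fun i => rfl
  have hV1 : ∀ i, V i 1 = if A.Adj (x i) (v i) then x i else x i + 1 := fun i => rfl
  refine core hs A hA (fun i => x (f i)) (fun i => V (f i)) ?_ ?_ ?_ ?_ ?_ ?_ D Lt Eq
    (fun p q => if h : p < ℓ + 2 ∧ q < ℓ + 2 then F ⟨p, h.1⟩ ⟨q, h.2⟩ else True) ?_ ?_ ?_ ?_
  · intro i hi p q hpq h2 hq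
    have := h (f i) (hf i hi)
    simp only [V]
    split_ifs <;> omega
  · intro i hi p hp
    have := h (f i) (hf i hi)
    simp only [V]
    split_ifs <;> omega
  · intro i hi
    simp only [hV0, hV1]
    split_ifs <;> omega
  · intro i j hij hj
    exact hx _ _ (hc i j hij hj).1 (hf j hj)
  · intro i hi
    simp only [hVl]
    exact (h (f i) (hf i hi)).1
  · intro i hi
    have := h (f i) (hf i hi)
    simp only [hVl, hV0, hV1]
    split_ifs with h1
    · exact ⟨by tauto, h1⟩
    · exact ⟨h1, by tauto⟩
  · intro i j hij hj
    have := (hc i j hij hj).2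
    simp only [Prod.mk.injEq] at this
    exact iff_of_eq this.1
  · intro i j hij hj
    have := (hc i j hij hj).2
    simp only [Prod.mk.injEq] at this
    exact iff_of_eq this.2.1
  · intro i j hij hj
    have := (hc i j hij hj).2
    simp only [Prod.mk.injEq] at this
    exact iff_of_eq this.2.2.1
  · intro i j hij hj p q hp hq
    have := (hc i j hij hj).2
    simp only [Prod.mk.injEq] at this
    rw [dif_pos ⟨by omega, by omega⟩]
    have h2 := congrFun (congrFun this.2.2.2 ⟨p, by omega⟩) ⟨q, by omega⟩
    exact iff_of_eq h2

end OG

namespace OG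

/-- `x` and `y` are not separated by a cut in `C` -/
def same (C : Finset ℕ) (x y : ℕ) : Prop := ∀ c ∈ C, (c ≤ x ↔ c ≤ y)

lemma same.symm {C : Finset ℕ} {x y : ℕ} (h : same C x y) : same C y x :=
  fun c hc => (h c hc).symm

lemma same.trans {C : Finset ℕ} {x y z : ℕ} (h : same C x y) (h' : same C y z) : same C x z :=
  fun c hc => (h c hc).trans (h' c hc)

lemma same.refl (C : Finset ℕ) (x : ℕ) : same C x x := fun _ _ => Iff.rfl

lemma same.mono {C C' : Finset ℕ} {x y : ℕ} (h : same C x y) (hC : C' ⊆ C) : same C' x y :=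
  fun c hc => h c (hC hc)

lemma same.btw {C : Finset ℕ} {x y z : ℕ} (h : same C x z) (h1 : x ≤ y) (h2 : y ≤ z) :
    same C x y := by
  intro c hc
  have := h c hc
  constructor <;> intro h' <;> omega

lemma same.btw' {C : Finset ℕ} {x y z : ℕ} (h : same C x z) (h1 : x ≤ y) (h2 : y ≤ z) :
    same C y z := (h.btw h1 h2).symm.trans h

/-- right change -/
def rchg (ℓ N : ℕ) (A : SimpleGraph ℕ) (x : ℕ) : Prop :=
  ∃ v < N, x + 1 + ℓ ≤ v ∧ ¬ (A.Adj x v ↔ A.Adj (x + 1) v)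

/-- left change -/
def lchg (ℓ N : ℕ) (A : SimpleGraph ℕ) (x : ℕ) : Prop :=
  ∃ v, v + ℓ ≤ x ∧ x + 1 < N ∧ ¬ (A.Adj v x ↔ A.Adj v (x + 1))

lemma rchg_card {P : HerProp} {n ℓ : ℕ} (hs : Slow P n ℓ) : ∃ K, ∀ N (A : SimpleGraph ℕ),
    A.comap (fun i : Fin N => (i : ℕ)) ∈ P.mem N → ∀ S : Finset ℕ, (∀ x ∈ S, rchg ℓ N A x) →
    S.card ≤ K := by
  obtain ⟨K, hK⟩ := no_changes hs
  refine ⟨2 * K, ?_⟩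
  intro N A hA S hS
  by_contra hlt
  obtain ⟨f, hf, hm⟩ := pick_seq S
  have : ∀ i, ∃ v, i < S.card → v < N ∧ f i + 1 + ℓ ≤ v ∧ ¬ (A.Adj (f i) v ↔ A.Adj (f i + 1) v) := by
    intro i
    by_cases hi : i < S.card
    · obtain ⟨v, h1, h2, h3⟩ := hS _ (hf i hi)
      exact ⟨v, fun _ => ⟨h1, h2, h3⟩⟩
    · exact ⟨0, fun h => absurd h hi⟩
  choose v hv using this
  refine hK N A hA (fun i => f (2 * i)) (fun i => v (2 * i)) ?_ ?_
  · intro i hi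
    exact hv (2 * i) (by omega)
  · intro i j hij hj
    have h1 := hm (2 * i) (2 * i + 1) (by omega) (by omega)
    have h2 := hm (2 * i + 1) (2 * j) (by omega) (by omega)
    omega

lemma lchg_card {P : HerProp} {n ℓ : ℕ} (hs : Slow P n ℓ) : ∃ K, ∀ N (A : SimpleGraph ℕ),
    A.comap (fun i : Fin N => (i : ℕ)) ∈ P.mem N → ∀ S : Finset ℕ, (∀ x ∈ S, lchg ℓ N A x) →
    S.card ≤ K := by
  classical
  obtain ⟨K, hK⟩ := rchg_card hs.rvs
  refine ⟨K, ?_⟩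
  intro N A hA S hS
  have h := hK N (rvg N A) (mem_rvs P hA) (S.image (fun x => N - 2 - x)) ?_
  · rwa [Finset.card_image_of_injOn] at h
    intro x hx y hy hxy
    obtain ⟨_, _, h1, _⟩ := hS x hx
    obtain ⟨_, _, h2, _⟩ := hS y hy
    dsimp only at hxy
    omega
  · intro x' hx'
    obtain ⟨x, hx, rfl⟩ := Finset.mem_image.mp hx'
    obtain ⟨v, h1, h2, h3⟩ := hS x hx
    refine ⟨N - 1 - v, by omega, by omega, ?_⟩
    simp only [rvg, SimpleGraph.comap_adj]
    rw [show N - 1 - (N - 2 - x) = x + 1 by omega, show N - 1 - (N - 1 - v) = v by omega,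
      show N - 1 - (N - 2 - x + 1) = x by omega, A.adj_comm, A.adj_comm x]
    tauto

lemma cuts {P : HerProp} {n ℓ : ℕ} (hs : Slow P n ℓ) : ∃ K, ∀ N (A : SimpleGraph ℕ),
    A.comap (fun i : Fin N => (i : ℕ)) ∈ P.mem N → ∃ C : Finset ℕ, C.card ≤ K ∧
    ∀ x, rchg ℓ N A x ∨ lchg ℓ N A x → x + 1 ∈ C := by
  classical
  obtain ⟨K, hK⟩ := rchg_card hs
  obtain ⟨K', hK'⟩ := lchg_card hs
  refine ⟨K + K', ?_⟩
  intro N A hA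
  refine ⟨((Finset.range N).filter (rchg ℓ N A)).image (· + 1) ∪
    ((Finset.range N).filter (lchg ℓ N A)).image (· + 1), ?_, ?_⟩
  · refine (Finset.card_union_le _ _).trans ?_
    refine Nat.add_le_add (Finset.card_image_le.trans (hK N A hA _ ?_))
      (Finset.card_image_le.trans (hK' N A hA _ ?_))
    · intro x hx; exact (Finset.mem_filter.mp hx).2
    · intro x hx; exact (Finset.mem_filter.mp hx).2
  · rintro x (h | h)
    · apply Finset.mem_union_left
      refine Finset.mem_image.mpr ⟨x, Finset.mem_filter.mpr ⟨?_, h⟩, rfl⟩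
      obtain ⟨v, h1, h2, _⟩ := h
      rw [Finset.mem_range]; omega
    · apply Finset.mem_union_right
      refine Finset.mem_image.mpr ⟨x, Finset.mem_filter.mpr ⟨?_, h⟩, rfl⟩
      obtain ⟨v, h1, h2, _⟩ := h
      rw [Finset.mem_range]; omega

/-- far adjacency depends only on the classes -/
lemma far_const {ℓ N : ℕ} {A : SimpleGraph ℕ} {C : Finset ℕ}
    (hC : ∀ x, rchg ℓ N A x ∨ lchg ℓ N A x → x + 1 ∈ C) {x x' v v' : ℕ}
    (hx : same C x x') (hv : same C v v') (h : x + ℓ ≤ v) (h' : x' + ℓ ≤ v') (hN : v < N)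
    (hN' : v' < N) : A.Adj x v ↔ A.Adj x' v' := by
  have h1 : ∀ x x' v, x ≤ x' → same C x x' → x' + ℓ ≤ v → v < N → (A.Adj x v ↔ A.Adj x' v) := by
    intro x x' v hle
    induction x', hle using Nat.le_induction with
    | base => intros; rfl
    | succ y hy ih =>
      intro hsame hl hN
      rw [ih (hsame.btw hy (by omega)) (by omega) hN]
      by_contra hne
      have := hsame _ (hC y (Or.inl ⟨v, hN, hl, hne⟩))
      omega
  have h2 : ∀ v v' x, v ≤ v' → same C v v' → x + ℓ ≤ v → v' < N → (A.Adj x v ↔ A.Adj x v') := by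
    intro v v' x hle
    induction v', hle using Nat.le_induction with
    | base => intros; rfl
    | succ y hy ih =>
      intro hsame hl hN
      rw [ih (hsame.btw hy (by omega)) hl (by omega)]
      by_contra hne
      have := hsame _ (hC y (Or.inr ⟨x, by omega, hN, hne⟩))
      omega
  have key : ∀ x x' v v', same C x x' → same C v v' → x + ℓ ≤ v → x' + ℓ ≤ v' → v < N → v' < N →
      x ≤ x' → (A.Adj x v ↔ A.Adj x' v') := by
    intro x x' v v' hx hv h h' hN hN' hle
    rw [← h1 x x' v' hle hx h' hN']
    rcases le_total v v' with hvv | hvv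
    · exact h2 v v' x hvv hv h hN'
    · exact (h2 v' v x hvv hv.symm (by omega) hN).symm
  rcases le_total x x' with hle | hle
  · exact key x x' v v' hx hv h h' hN hN' hle
  · exact (key x' x v' v hx.symm hv.symm h' h hN' hN hle).symm

/-- the value on far pairs within a class -/
def cval (C : Finset ℕ) (ℓ N : ℕ) (A : SimpleGraph ℕ) (x : ℕ) : Prop :=
  ∃ u v, same C x u ∧ same C x v ∧ u + ℓ ≤ v ∧ v < N ∧ A.Adj u v

lemma cval_iff {ℓ N : ℕ} {A : SimpleGraph ℕ} {C : Finset ℕ}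
    (hC : ∀ x, rchg ℓ N A x ∨ lchg ℓ N A x → x + 1 ∈ C) {x u v : ℕ} (h1 : same C x u)
    (h2 : same C x v) (h3 : u + ℓ ≤ v) (h4 : v < N) : A.Adj u v ↔ cval C ℓ N A x := by
  constructor
  · intro h; exact ⟨u, v, h1, h2, h3, h4, h⟩
  · rintro ⟨u', v', a, b, c, d, e⟩
    exact (far_const hC (h1.symm.trans a) (h2.symm.trans b) h3 c h4 d).2 e

lemma cval_same {ℓ N : ℕ} {A : SimpleGraph ℕ} {C : Finset ℕ} {x y : ℕ} (h : same C x y) :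
    cval C ℓ N A x ↔ cval C ℓ N A y := by
  constructor
  · rintro ⟨u, v, a, b, c⟩; exact ⟨u, v, h.symm.trans a, h.symm.trans b, c⟩
  · rintro ⟨u, v, a, b, c⟩; exact ⟨u, v, h.trans a, h.trans b, c⟩

/-- increasing sequence of length `m` in `[s,t)` -/
def InIv (s t m : ℕ) (S : ℕ → ℕ) : Prop :=
  (∀ p q, p < q → q < m → S p < S q) ∧ ∀ p < m, s ≤ S p ∧ S p < t

/-- bad intervals -/
def Bad (B : SimpleGraph ℕ) (ℓ s t : ℕ) : Prop :=
  (∃ S, InIv s t (ℓ + 1) S ∧ Irr B.Adj (ℓ + 1) S) ∨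
  ∃ r, r ≤ ℓ ∧ 1 ≤ r ∧ ∃ S S', InIv s t r S ∧ InIv s t r S' ∧ Irr B.Adj r S ∧ Irr B.Adj r S' ∧
    ∃ p < r, ∃ q < r, ¬ (B.Adj (S p) (S q) ↔ B.Adj (S' p) (S' q))

lemma InIv.mono {s t s' t' m : ℕ} {S : ℕ → ℕ} (h : InIv s t m S) (h1 : s' ≤ s) (h2 : t ≤ t') :
    InIv s' t' m S :=
  ⟨h.1, fun p hp => ⟨h1.trans (h.2 p hp).1, (h.2 p hp).2.trans_le h2⟩⟩

lemma Bad.mono {B : SimpleGraph ℕ} {ℓ s t s' t' : ℕ} (h : Bad B ℓ s t) (h1 : s' ≤ s) (h2 : t ≤ t') :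
    Bad B ℓ s' t' := by
  rcases h with ⟨S, a, b⟩ | ⟨r, a, b, S, S', c, d, e⟩
  · exact Or.inl ⟨S, a.mono h1 h2, b⟩
  · exact Or.inr ⟨r, a, b, S, S', c.mono h1 h2, d.mono h1 h2, e⟩

lemma not_bad_single {B : SimpleGraph ℕ} {ℓ : ℕ} (hl : 1 ≤ ℓ) (u : ℕ) : ¬ Bad B ℓ u (u + 1) := by
  rintro (⟨S, a, b⟩ | ⟨r, a, b, S, S', c, d, e, f, p, hp, q, hq, g⟩)
  · have h1 := a.1 0 1 (by omega) (by omega)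
    have h2 := a.2 0 (by omega)
    have h3 := a.2 1 (by omega)
    omega
  · by_cases hr : r = 1
    · have : p = q := by omega
      subst this
      exact g (by simp)
    · have h1 := c.1 0 1 (by omega) (by omega)
      have h2 := c.2 0 (by omega)
      have h3 := c.2 1 (by omega)
      omega

lemma bad_lt {B : SimpleGraph ℕ} {ℓ s t : ℕ} (h : Bad B ℓ s t) : s < t := by
  rcases h with (⟨S, a, b⟩ | ⟨r, a, b, S, S', c, d, e⟩)
  · have := a.2 0 (by omega); omega
  · have := c.2 0 (by omega); omega

lemma nobad {P : HerProp} {n ℓ : ℕ} (hs : Slow P n ℓ) : ∃ K, ∀ N (B : SimpleGraph ℕ),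
    B.comap (fun i : Fin N => (i : ℕ)) ∈ P.mem N → ∀ s t, t ≤ N →
    (∀ u v, s ≤ u → u + ℓ ≤ v → v < t → ¬ B.Adj u v) → ∀ a b : ℕ → ℕ,
    (∀ i < K, Bad B ℓ (a i) (b i) ∧ s ≤ a i ∧ b i ≤ t) → (∀ i j, i < j → j < K → b i ≤ a j) →
    False := by
  classical
  obtain ⟨R, hR⟩ := pigeon (κ := Option (Fin (ℓ + 1))) n
  refine ⟨R * (ℓ + 1), ?_⟩
  intro N B hB s t ht hfar a b hbad hsep
  let Q : ℕ → Option (Fin (ℓ + 1)) → Prop := fun i o => match o with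
    | none => ∃ S, InIv (a i) (b i) (ℓ + 1) S ∧ Irr B.Adj (ℓ + 1) S
    | some r => 1 ≤ (r : ℕ) ∧ ∃ S S', InIv (a i) (b i) r S ∧ InIv (a i) (b i) r S' ∧
        Irr B.Adj r S ∧ Irr B.Adj r S' ∧
        ∃ p < (r : ℕ), ∃ q < (r : ℕ), ¬ (B.Adj (S p) (S q) ↔ B.Adj (S' p) (S' q))
  have hex : ∀ j, ∃ o, j < R → Q (j * (ℓ + 1)) o := by
    intro j
    by_cases hj : j < R
    · have hlt : j * (ℓ + 1) < R * (ℓ + 1) := Nat.mul_lt_mul_of_pos_right hj (by omega)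
      rcases (hbad _ hlt).1 with h | ⟨r, h1, h2, h⟩
      · exact ⟨none, fun _ => h⟩
      · exact ⟨some ⟨r, by omega⟩, fun _ => ⟨h2, h⟩⟩
    · exact ⟨none, fun h => absurd h hj⟩
  choose o ho using hex
  obtain ⟨k, T, hT, hcard, hk⟩ := hR o (Finset.range R) (by simp)
  obtain ⟨f, hf, hfm⟩ := pick_seq T
  have hfR : ∀ i < n, f i < R := fun i hi => Finset.mem_range.mp (hT (hf i (by omega)))
  have hfK : ∀ i < n, f i * (ℓ + 1) < R * (ℓ + 1) := fun i hi =>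
    Nat.mul_lt_mul_of_pos_right (hfR i hi) (by omega)
  -- separation
  have hstep : ∀ m i, i + m < R * (ℓ + 1) → a i + m ≤ a (i + m) := by
    intro m
    induction m with
    | zero => intro i _; simp
    | succ m ih =>
      intro i hi
      have h1 := ih i (by omega)
      have h2 := hsep (i + m) (i + m + 1) (by omega) (by omega)
      have h3 := bad_lt (hbad (i + m) (by omega)).1
      rw [show i + (m + 1) = i + m + 1 from rfl]
      omega
  let V : ℕ → Set ℕ := fun i => {u | a (f i * (ℓ + 1)) ≤ u ∧ u < b (f i * (ℓ + 1))}
  have hV : ∀ i j, i < j → j < n → ∀ u ∈ V i, ∀ v ∈ V j, u < v ∧ ¬ B.Adj u v := by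
    rintro i j hij hj u ⟨hu1, hu2⟩ v ⟨hv1, hv2⟩
    have hlt := hfm i j hij (by omega)
    have hle : f i * (ℓ + 1) + (ℓ + 1) ≤ f j * (ℓ + 1) := by
      have := Nat.mul_le_mul_right (ℓ + 1) (show f i + 1 ≤ f j from hlt)
      linarith
    have hK := hfK j hj
    have h1 := hstep (f j * (ℓ + 1) - (f i * (ℓ + 1) + 1)) (f i * (ℓ + 1) + 1) (by omega)
    rw [show f i * (ℓ + 1) + 1 + (f j * (ℓ + 1) - (f i * (ℓ + 1) + 1)) = f j * (ℓ + 1) by omega] at h1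
    have h2 := hsep (f i * (ℓ + 1)) (f i * (ℓ + 1) + 1) (by omega) (by omega)
    have h3 := hbad _ (hfK i (by omega))
    have h4 := hbad _ hK
    exact ⟨by omega, hfar u v (by omega) (by omega) (by omega)⟩
  have hQ : ∀ i < n, Q (f i * (ℓ + 1)) k := by
    intro i hi
    have := ho (f i) (hfR i hi)
    rwa [hk _ (hf i (by omega))] at this
  have conv : ∀ i < n, ∀ r S, InIv (a (f i * (ℓ + 1))) (b (f i * (ℓ + 1))) r S →
      (∀ p q, p < q → q < r → S p < S q) ∧ (∀ p < r, S p ∈ V i ∧ S p < N) := by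
    intro i hi r S h
    refine ⟨h.1, fun p hp => ⟨h.2 p hp, ?_⟩⟩
    have h1 := (h.2 p hp).2
    have h2 := (hbad _ (hfK i hi)).2.2
    omega
  rcases k with _ | r
  · have : ∀ i, ∃ S, i < n → InIv (a (f i * (ℓ + 1))) (b (f i * (ℓ + 1))) (ℓ + 1) S ∧
        Irr B.Adj (ℓ + 1) S := by
      intro i
      by_cases hi : i < n
      · obtain ⟨S, h⟩ := hQ i hi
        exact ⟨S, fun _ => h⟩
      · exact ⟨id, fun h => absurd h hi⟩
    choose S hS using this
    refine hs.fib (sumA P B hB V hV S ?_)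
    intro i hi
    obtain ⟨h1, h2⟩ := conv i hi _ _ (hS i hi).1
    exact ⟨h1, h2, (hS i hi).2⟩
  · have h1r : 1 ≤ (r : ℕ) := (hQ 0 hs.1).1
    have : ∀ i, ∃ S S', i < n → InIv (a (f i * (ℓ + 1))) (b (f i * (ℓ + 1))) r S ∧
        InIv (a (f i * (ℓ + 1))) (b (f i * (ℓ + 1))) r S' ∧
        Irr B.Adj r S ∧ Irr B.Adj r S' ∧
        ∃ p < (r : ℕ), ∃ q < (r : ℕ), ¬ (B.Adj (S p) (S q) ↔ B.Adj (S' p) (S' q)) := by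
      intro i
      by_cases hi : i < n
      · obtain ⟨_, S, S', h⟩ := hQ i hi
        exact ⟨S, S', fun _ => h⟩
      · exact ⟨id, id, fun h => absurd h hi⟩
    choose S S' hS using this
    have := sumB P h1r B hB V hV S S' ?_ ?_ (fun i hi => (hS i hi).2.2.2.2)
    · rw [pw_eq hs.1] at this
      exact hs.two this
    · intro i hi
      obtain ⟨h1, h2⟩ := conv i hi _ _ (hS i hi).1
      exact ⟨h1, h2, (hS i hi).2.2.1⟩
    · intro i hi
      obtain ⟨h1, h2⟩ := conv i hi _ _ (hS i hi).2.1
      exact ⟨h1, h2, (hS i hi).2.2.2.1⟩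

lemma greedy (Bd : ℕ → ℕ → Prop) (hmono : ∀ s t s' t', Bd s t → s' ≤ s → t ≤ t' → Bd s' t')
    (hsing : ∀ u, ¬ Bd u (u + 1)) (K : ℕ) : ∀ s t,
    (∀ a b : ℕ → ℕ, (∀ i < K, Bd (a i) (b i) ∧ s ≤ a i ∧ b i ≤ t) →
      (∀ i j, i < j → j < K → b i ≤ a j) → False) →
    ∃ C : Finset ℕ, C.card ≤ 2 * K ∧ ∀ u v, s ≤ u → u ≤ v → v < t → same C u v → ¬ Bd u (v + 1) := by
  classical
  induction K with
  | zero =>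
    intro s t h
    exact (h id id (by simp) (by simp)).elim
  | succ K ih =>
    intro s t h
    by_cases hb : Bd s t
    · let e := Nat.find (⟨t, hb⟩ : ∃ e, Bd s e)
      have he : Bd s e := Nat.find_spec (⟨t, hb⟩ : ∃ e, Bd s e)
      have hmin : ∀ e' < e, ¬ Bd s e' := fun e' h' => Nat.find_min (⟨t, hb⟩ : ∃ e, Bd s e) h'
      have het : e ≤ t := Nat.find_min' (⟨t, hb⟩ : ∃ e, Bd s e) hb
      have hse : s ≤ e := by
        by_contra hlt
        exact hsing e (hmono _ _ _ _ he (by omega) (by omega))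
      obtain ⟨C, hC, hC'⟩ := ih e t (by
        intro a b hab hsep
        refine h (fun i => if i = 0 then s else a (i - 1)) (fun i => if i = 0 then e else b (i - 1))
          ?_ ?_
        · intro i hi
          by_cases h0 : i = 0
          · simp only [h0, if_true]; exact ⟨he, le_rfl, het⟩
          · simp only [h0, if_false]
            obtain ⟨h1, h2, h3⟩ := hab (i - 1) (by omega)
            exact ⟨h1, by omega, h3⟩
        · intro i j hij hj
          have hj0 : j ≠ 0 := by omega
          by_cases h0 : i = 0
          · simp only [h0, hj0, if_true, if_false]
            exact (hab (j - 1) (by omega)).2.1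
          · simp only [h0, hj0, if_false]
            exact hsep _ _ (by omega) (by omega))
      refine ⟨insert e (insert (e - 1) C), ?_, ?_⟩
      · have := Finset.card_insert_le e (insert (e - 1) C)
        have := Finset.card_insert_le (e - 1) C
        omega
      · intro u v hu huv hv hsame hbd
        by_cases hue : e ≤ u
        · exact hC' u v hue huv hv (hsame.mono (by intro x hx; simp [hx])) hbd
        · have h1 := hsame e (by simp)
          have h2 := hsame (e - 1) (by simp)
          by_cases hve : v < e - 1
          · exact hmin (v + 1) (by omega) (hmono _ _ _ _ hbd hu le_rfl)
          · have : u = v := by omega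
            subst this
            exact hsing u hbd
    · refine ⟨∅, by simp, ?_⟩
      intro u v hu huv hv _ hbd
      exact hb (hmono _ _ _ _ hbd hu (by omega))

open Classical in
/-- `A` or its complement -/
noncomputable def Jc (A : SimpleGraph ℕ) (c : Prop) : SimpleGraph ℕ := if c then Aᶜ else A

lemma Jc_adj (A : SimpleGraph ℕ) (c : Prop) (u v : ℕ) :
    (Jc A c).Adj u v ↔ u ≠ v ∧ ¬ (A.Adj u v ↔ c) := by
  unfold Jc
  split_ifs with h
  · rw [SimpleGraph.compl_adj]; tauto
  · have : A.Adj u v → u ≠ v := fun h => h.ne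
    tauto

/-- Summary of the structural analysis. -/
lemma structure_cuts {P : HerProp} {n ℓ : ℕ} (hs : Slow P n ℓ) : ∃ K, ∀ N (A : SimpleGraph ℕ),
    A.comap (fun i : Fin N => (i : ℕ)) ∈ P.mem N → ∃ (C : Finset ℕ) (c : ℕ → Prop), C.card ≤ K ∧
    (∀ x y, same C x y → (c x ↔ c y)) ∧
    (∀ x v x' v', same C x x' → same C v v' → x + ℓ ≤ v → x' + ℓ ≤ v' → v < N → v' < N →
      (A.Adj x v ↔ A.Adj x' v')) ∧
    (∀ x v, same C x v → x + ℓ ≤ v → v < N → (A.Adj x v ↔ c x)) ∧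
    (∀ u v, u ≤ v → v < N → same C u v → ¬ Bad (Jc A (c u)) ℓ u (v + 1)) := by
  classical
  obtain ⟨K1, hK1⟩ := cuts hs
  obtain ⟨K2, hK2⟩ := nobad hs
  obtain ⟨K3, hK3⟩ := nobad hs.cpl
  refine ⟨K1 + (K1 + 1) * (2 * (K2 + K3)), ?_⟩
  intro N A hA
  obtain ⟨C0, hC0, hcut⟩ := hK1 N A hA
  set c := cval C0 ℓ N A with hc
  let tx : ℕ → ℕ := fun x => ((Finset.range N).filter (fun v => same C0 x v)).sup (· + 1)
  have tx1 : ∀ x v, v < N → same C0 x v → v < tx x := by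
    intro x v hv h
    exact Finset.le_sup (f := (· + 1)) (Finset.mem_filter.mpr ⟨Finset.mem_range.mpr hv, h⟩)
  have txN : ∀ x, tx x ≤ N := by
    intro x
    apply Finset.sup_le
    intro v hv
    exact Finset.mem_range.mp (Finset.mem_filter.mp hv).1
  have tx2 : ∀ x u, x ≤ u → u < tx x → same C0 x u := by
    intro x u hxu hu
    obtain ⟨v, hv, h⟩ := Finset.lt_sup_iff.mp hu
    exact (Finset.mem_filter.mp hv).2.btw hxu (by omega)
  have hblock : ∀ x, ∃ C : Finset ℕ, C.card ≤ 2 * (K2 + K3) ∧ ∀ u v, x ≤ u → u ≤ v → v < tx x →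
      same C u v → ¬ Bad (Jc A (c x)) ℓ u (v + 1) := by
    intro x
    apply greedy (Bad (Jc A (c x)) ℓ) (fun s t s' t' h h1 h2 => h.mono h1 h2)
      (fun u => not_bad_single hs.2.1 u)
    intro a b hab hsep
    have hfar : ∀ u v, x ≤ u → u + ℓ ≤ v → v < tx x → ¬ (Jc A (c x)).Adj u v := by
      intro u v h1 h2 h3 h4
      rw [Jc_adj] at h4
      refine h4.2 ?_
      have := txN x
      exact cval_iff hcut (tx2 x u h1 (by omega)) (tx2 x v (by omega) h3) h2 (by omega)
    by_cases hcx : c x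
    · refine hK3 N (Jc A (c x)) ?_ x (tx x) (txN x) hfar a b (fun i hi => hab i (by omega))
        (fun i j hij hj => hsep i j hij (by omega))
      unfold Jc; rw [if_pos hcx]; exact mem_cpl P hA
    · refine hK2 N (Jc A (c x)) ?_ x (tx x) (txN x) hfar a b (fun i hi => hab i (by omega))
        (fun i j hij hj => hsep i j hij (by omega))
      unfold Jc; rw [if_neg hcx]; exact hA
  choose D hD hD' using hblock
  have hsub : C0 ⊆ C0 ∪ (insert 0 C0).biUnion D := Finset.subset_union_left
  refine ⟨C0 ∪ (insert 0 C0).biUnion D, c, ?_, ?_, ?_, ?_, ?_⟩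
  · refine (Finset.card_union_le _ _).trans (Nat.add_le_add hC0 ?_)
    refine (Finset.card_biUnion_le_card_mul _ _ _ (fun x _ => hD x)).trans ?_
    apply Nat.mul_le_mul_right
    have := Finset.card_insert_le 0 C0
    omega
  · intro x y h; exact cval_same (h.mono hsub)
  · intro x v x' v' h1 h2 h3 h4 h5 h6
    exact far_const hcut (h1.mono hsub) (h2.mono hsub) h3 h4 h5 h6
  · intro x v h1 h2 h3
    exact cval_iff hcut (same.refl _ _) (h1.mono hsub) h2 h3
  · intro u v huv hv hsame
    -- the block containing u
    have hne : ((insert 0 C0).filter (· ≤ u)).Nonempty := ⟨0, by simp⟩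
    set x := ((insert 0 C0).filter (· ≤ u)).max' hne with hx
    have hxm := Finset.max'_mem _ hne
    rw [← hx, Finset.mem_filter] at hxm
    have hxu : same C0 x u := by
      intro d hd
      constructor
      · intro h; exact h.trans hxm.2
      · intro h
        exact Finset.le_max' _ _ (Finset.mem_filter.mpr ⟨Finset.mem_insert_of_mem hd, h⟩)
    have hxv := hxu.trans (hsame.mono hsub)
    have hcc : c u = c x := propext (cval_same hxu.symm)
    rw [hcc]
    refine hD' x u v hxm.2 huv (tx1 x v hv hxv) (hsame.mono ?_)
    intro y hy
    exact Finset.mem_union_right _ (Finset.mem_biUnion.mpr ⟨x, hxm.1, hy⟩)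

end OG

namespace OG

/-- uniqueness of irreducible patterns in `[0,m)` -/
def Uniq (B : SimpleGraph ℕ) (m : ℕ) : Prop :=
  ∀ r S S', 1 ≤ r → InIv 0 m r S → InIv 0 m r S' → Irr B.Adj r S → Irr B.Adj r S' →
    ∀ p < r, ∀ q < r, (B.Adj (S p) (S q) ↔ B.Adj (S' p) (S' q))

def s3 (i j k p : ℕ) : ℕ := if p = 0 then i else if p = 1 then j else k

/-- quadruple -/
def s4 (i j k l p : ℕ) : ℕ := if p = 0 then i else if p = 1 then j else if p = 2 then k else l

lemma iv3 {m i j k : ℕ} (h1 : i < j) (h2 : j < k) (h3 : k < m) : InIv 0 m 3 (s3 i j k) := by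
  refine ⟨?_, ?_⟩
  · intro p q hpq hq
    unfold s3; split_ifs <;> omega
  · intro p hp
    unfold s3; split_ifs <;> omega

lemma iv4 {m i j k l : ℕ} (h1 : i < j) (h2 : j < k) (h3 : k < l) (h4 : l < m) :
    InIv 0 m 4 (s4 i j k l) := by
  refine ⟨?_, ?_⟩
  · intro p q hpq hq
    unfold s4; split_ifs <;> omega
  · intro p hp
    unfold s4; split_ifs <;> omega

lemma irr3 {B : ℕ → ℕ → Prop} {i j k : ℕ} (h : B i k ∨ (B i j ∧ B j k)) : Irr B 3 (s3 i j k) := by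
  intro g hg0 hg
  rcases h with h | ⟨h1, h2⟩
  · exact ⟨0, hg0, 2, by omega, by omega, h⟩
  · have : g = 1 ∨ g = 2 := by omega
    rcases this with rfl | rfl
    · exact ⟨0, by omega, 1, by omega, by omega, h1⟩
    · exact ⟨1, by omega, 2, by omega, by omega, h2⟩

lemma irr4a {B : ℕ → ℕ → Prop} {i j k l : ℕ} (h : B i l) : Irr B 4 (s4 i j k l) := by
  intro g hg0 hg
  exact ⟨0, hg0, 3, by omega, by omega, h⟩

lemma irr4b {B : ℕ → ℕ → Prop} {i j k l : ℕ} (h : B i k) (h' : B j l) : Irr B 4 (s4 i j k l) := by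
  intro g hg0 hg
  by_cases hg' : g ≤ 2
  · exact ⟨0, hg0, 2, by omega, by omega, h⟩
  · exact ⟨1, by omega, 3, by omega, by omega, h'⟩

lemma irr3' {B : ℕ → ℕ → Prop} {S : ℕ → ℕ} (h : Irr B 3 S) :
    B (S 0) (S 2) ∨ (B (S 0) (S 1) ∧ B (S 1) (S 2)) := by
  obtain ⟨i, hi, j, hj, hj', h1⟩ := h 1 (by omega) (by omega)
  obtain ⟨i', hi', j', hj1, hj1', h2⟩ := h 2 (by omega) (by omega)
  have e1 : i = 0 := by omega
  have e2 : j' = 2 := by omega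
  subst e1 e2
  have : j = 1 ∨ j = 2 := by omega
  have : i' = 0 ∨ i' = 1 := by omega
  rcases ‹j = 1 ∨ j = 2› with rfl | rfl <;> rcases ‹i' = 0 ∨ i' = 1› with rfl | rfl <;> tauto

/-- equality of graphs from the ordered adjacency -/
lemma graph_eq {m : ℕ} {G H : SimpleGraph (Fin m)}
    (h : ∀ i j : Fin m, i < j → (G.Adj i j ↔ H.Adj i j)) : G = H := by
  ext i j
  rcases lt_trichotomy i j with h1 | h1 | h1
  · exact h i j h1
  · subst h1; simp
  · rw [G.adj_comm, H.adj_comm]; exact h j i h1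

theorem q2_eq (B : SimpleGraph ℕ) (h03 : B.Adj 0 3) (h12 : B.Adj 1 2) (n01 : ¬ B.Adj 0 1)
    (n02 : ¬ B.Adj 0 2) (n13 : ¬ B.Adj 1 3) (n23 : ¬ B.Adj 2 3) :
    B.comap (fun i : Fin 4 => (i : ℕ)) = Qgraph2 := by
  apply graph_eq
  intro i j hij
  simp only [Qgraph2, SimpleGraph.fromRel_adj, SimpleGraph.comap_adj]
  obtain ⟨i, hi⟩ := i
  obtain ⟨j, hj⟩ := j
  simp only [Fin.mk_lt_mk] at hij
  interval_cases j <;> interval_cases i <;> simp [*]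

theorem q1_eq (B : SimpleGraph ℕ) (h02 : B.Adj 0 2) (h13 : B.Adj 1 3) (n01 : ¬ B.Adj 0 1)
    (n03 : ¬ B.Adj 0 3) (n12 : ¬ B.Adj 1 2) (n23 : ¬ B.Adj 2 3) :
    B.comap (fun i : Fin 4 => (i : ℕ)) = Qgraph1 := by
  apply graph_eq
  intro i j hij
  simp only [Qgraph1, SimpleGraph.fromRel_adj, SimpleGraph.comap_adj]
  obtain ⟨i, hi⟩ := i
  obtain ⟨j, hj⟩ := j
  simp only [Fin.mk_lt_mk] at hij
  interval_cases j <;> interval_cases i <;> simp [*]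

lemma classify (B : SimpleGraph ℕ) (m ℓ : ℕ) (hm : m ≤ ℓ) (hirr : Irr B.Adj m id)
    (hu : Uniq B m) : InJle ℓ (B.comap (fun i : Fin m => (i : ℕ))) := by
  classical
  have hgap : ∀ g, 0 < g → g < m → ∃ i j, i < g ∧ g ≤ j ∧ j < m ∧ B.Adj i j := by
    intro g h1 h2
    obtain ⟨i, hi, j, hj, hj', h⟩ := hirr g h1 h2
    exact ⟨i, j, hi, hj, hj', h⟩
  by_cases hm3 : m < 3
  · left; refine ⟨hm, Or.inl ?_⟩
    apply graph_eq
    intro i j hij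
    have hi := i.2
    have hj := j.2
    have hij' : (i : ℕ) < j := hij
    simp only [Jgraph1, SimpleGraph.top_adj, SimpleGraph.comap_adj]
    refine ⟨fun _ => hij.ne, fun _ => ?_⟩
    obtain ⟨u, v, h1, h2, h3, h4⟩ := hgap 1 (by omega) (by omega)
    have e1 : u = i := by omega
    have e2 : v = j := by omega
    rw [← e1, ← e2]; exact h4
  obtain ⟨φ, hφ, hφm, hφi⟩ := irr_sub B.Adj m 3 (by omega) (by omega) id hirr
  have hφI : InIv 0 m 3 (fun i => id (φ i)) := ⟨fun p q hpq _ => hφ hpq, fun p hp => ⟨by omega, hφm p hp⟩⟩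
  have h0 := irr3' hφi
  obtain ⟨a, b, c, habc, htri⟩ : ∃ a b c : Prop, (c ∨ (a ∧ b)) ∧ ∀ i j k, i < j → j < k → k < m →
      B.Adj i k ∨ (B.Adj i j ∧ B.Adj j k) →
      (B.Adj i j ↔ a) ∧ (B.Adj j k ↔ b) ∧ (B.Adj i k ↔ c) := by
    refine ⟨_, _, _, h0, ?_⟩
    intro i j k h1 h2 h3 h4
    have := hu 3 _ _ (by omega) (iv3 h1 h2 h3) hφI (irr3 h4) hφi
    exact ⟨this 0 (by omega) 1 (by omega), this 1 (by omega) 2 (by omega),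
      this 0 (by omega) 2 (by omega)⟩
  by_cases hc : c
  swap
  · -- path
    have ha : a := by tauto
    have hb : b := by tauto
    have hlong : ∀ i k, i + 1 < k → k < m → ¬ B.Adj i k := by
      intro i k h1 h2 h3
      have := htri i (i + 1) k (by omega) h1 h2 (Or.inl h3)
      tauto
    left; refine ⟨hm, Or.inr (Or.inr (Or.inr (Or.inr ?_)))⟩
    apply graph_eq
    intro i j hij
    have hij' : (i : ℕ) < j := hij
    simp only [Lgraph, SimpleGraph.fromRel_adj, SimpleGraph.comap_adj]
    constructor
    · intro h
      refine ⟨hij.ne, Or.inl ?_⟩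
      by_contra hne
      exact hlong i j (by omega) j.2 h
    · rintro ⟨-, h⟩
      have hj : (j : ℕ) = i + 1 := by omega
      obtain ⟨u, v, h1, h2, h3, h4⟩ := hgap j (by omega) j.2
      have h5 : ¬ u + 1 < v := fun h => hlong u v h h3 h4
      have e1 : u = i := by omega
      have e2 : v = j := by omega
      rw [← e1, ← e2]; exact h4
  by_cases ha : a
  · by_cases hb : b
    · -- complete
      have hstep : ∀ g, 0 < g → g < m → B.Adj (g - 1) g := by
        intro g h1 h2
        obtain ⟨u, v, h3, h4, h5, h6⟩ := hgap g h1 h2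
        have h7 : B.Adj (g - 1) v := by
          by_cases h : u = g - 1
          · rw [← h]; exact h6
          · have := htri u (g - 1) v (by omega) (by omega) h5 (Or.inl h6)
            tauto
        by_cases h : v = g
        · rw [← h] at h7 ⊢; exact h7
        · have := htri (g - 1) g v (by omega) (by omega) h5 (Or.inl h7)
          tauto
      have hall : ∀ d i, i + d + 1 < m → B.Adj i (i + d + 1) := by
        intro d
        induction d with
        | zero => intro i hi; exact hstep (i + 1) (by omega) hi
        | succ d ih =>
          intro i hi
          have h1 := ih i (by omega)
          have h2 := hstep (i + d + 1 + 1) (by omega) (by omega)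
          have := htri i (i + d + 1) (i + d + 1 + 1) (by omega) (by omega) (by omega) (Or.inr ⟨h1, h2⟩)
          exact this.2.2.2 hc
      left; refine ⟨hm, Or.inl ?_⟩
      apply graph_eq
      intro i j hij
      have hij' : (i : ℕ) < j := hij
      simp only [Jgraph1, SimpleGraph.top_adj, SimpleGraph.comap_adj]
      refine ⟨fun _ => hij.ne, fun _ => ?_⟩
      have := hall (j - i - 1) i (by omega)
      rwa [show (i : ℕ) + (j - i - 1) + 1 = j by omega] at this
    · -- star at the first vertex
      have hp : ∀ i j k, i < j → j < k → k < m → ¬ (B.Adj i j ∧ B.Adj j k) := by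
        intro i j k h1 h2 h3 h4
        have := htri i j k h1 h2 h3 (Or.inr h4); tauto
      have he : ∀ i j k, i < j → j < k → k < m → B.Adj i k → B.Adj i j ∧ ¬ B.Adj j k := by
        intro i j k h1 h2 h3 h4
        have := htri i j k h1 h2 h3 (Or.inl h4); tauto
      have hmain : B.Adj 0 (m - 1) := by
        obtain ⟨i, k, h1, h2, h3, h4⟩ := hgap (m - 1) (by omega) (by omega)
        have hk : k = m - 1 := by omega
        subst hk
        by_cases hi : i = 0
        · rw [← hi]; exact h4
        obtain ⟨u, v, h5, h6, h7, h8⟩ := hgap i (by omega) (by omega)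
        exfalso
        by_cases hv : v = i
        · subst hv
          exact hp u v (m - 1) h5 h1 h3 ⟨h8, h4⟩
        · have h9 := he u i v h5 (by omega) h7 h8
          exact hp u i (m - 1) h5 h1 h3 ⟨h9.1, h4⟩
      have hstar : ∀ j, 0 < j → j < m → B.Adj 0 j := by
        intro j h1 h2
        by_cases hj : j = m - 1
        · rw [hj]; exact hmain
        · exact (he 0 j (m - 1) h1 (by omega) (by omega) hmain).1
      left; refine ⟨hm, Or.inr (Or.inr (Or.inl ?_))⟩
      apply graph_eq
      intro i j hij
      have hij' : (i : ℕ) < j := hij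
      simp only [Jgraph3, SimpleGraph.fromRel_adj, SimpleGraph.comap_adj]
      constructor
      · intro h
        refine ⟨hij.ne, Or.inl ?_⟩
        by_contra hne
        exact hp 0 i j (by omega) hij' j.2 ⟨hstar i (by omega) i.2, h⟩
      · rintro ⟨-, h⟩
        have hi : (i : ℕ) = 0 := by omega
        rw [hi]; exact hstar j (by omega) j.2
  · by_cases hb : b
    · -- star at the last vertex
      have hp : ∀ i j k, i < j → j < k → k < m → ¬ (B.Adj i j ∧ B.Adj j k) := by
        intro i j k h1 h2 h3 h4
        have := htri i j k h1 h2 h3 (Or.inr h4); tauto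
      have he : ∀ i j k, i < j → j < k → k < m → B.Adj i k → B.Adj j k ∧ ¬ B.Adj i j := by
        intro i j k h1 h2 h3 h4
        have := htri i j k h1 h2 h3 (Or.inl h4); tauto
      have hmain : B.Adj 0 (m - 1) := by
        obtain ⟨i, k, h1, h2, h3, h4⟩ := hgap 1 (by omega) (by omega)
        have hi : i = 0 := by omega
        subst hi
        by_cases hk : k = m - 1
        · rw [← hk]; exact h4
        obtain ⟨u, v, h5, h6, h7, h8⟩ := hgap (k + 1) (by omega) (by omega)
        exfalso
        by_cases huk : u = k
        · subst huk
          exact hp 0 u v (by omega) (by omega) h7 ⟨h4, h8⟩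
        · have h9 := he u k v (by omega) (by omega) h7 h8
          exact hp 0 k v (by omega) (by omega) h7 ⟨h4, h9.1⟩
      have hstar : ∀ j, j < m - 1 → B.Adj j (m - 1) := by
        intro j h1
        by_cases hj : j = 0
        · rw [hj]; exact hmain
        · exact (he 0 j (m - 1) (by omega) (by omega) (by omega) hmain).1
      left; refine ⟨hm, Or.inr (Or.inr (Or.inr (Or.inl ?_)))⟩
      apply graph_eq
      intro i j hij
      have hij' : (i : ℕ) < j := hij
      have hjm := j.2
      simp only [Jgraph4, SimpleGraph.fromRel_adj, SimpleGraph.comap_adj]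
      constructor
      · intro h
        refine ⟨hij.ne, Or.inl ?_⟩
        by_contra hne
        exact hp i j (m - 1) hij' (by omega) (by omega) ⟨h, hstar j (by omega)⟩
      · rintro ⟨-, h⟩
        have hj : (j : ℕ) = m - 1 := by omega
        rw [hj]; exact hstar i (by omega)
    · -- matching
      have hp : ∀ i j k, i < j → j < k → k < m → ¬ (B.Adj i j ∧ B.Adj j k) := by
        intro i j k h1 h2 h3 h4
        have := htri i j k h1 h2 h3 (Or.inr h4); tauto
      have he : ∀ i j k, i < j → j < k → k < m → B.Adj i k → ¬ B.Adj j k ∧ ¬ B.Adj i j := by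
        intro i j k h1 h2 h3 h4
        have := htri i j k h1 h2 h3 (Or.inl h4); tauto
      have hmatch : ∀ i j k, i < m → j < m → k < m → B.Adj i j → B.Adj i k → j = k := by
        have key : ∀ i j k, i < m → j < m → k < m → B.Adj i j → B.Adj i k → ¬ j < k := by
          intro i j k hi hj hk h1 h2 hlt
          have e1 := h1.ne
          have e2 := h2.ne
          rcases lt_or_gt_of_ne e1 with h3 | h3
          · exact (he i j k h3 hlt hk h2).2 h1
          · rcases lt_or_gt_of_ne e2 with h4 | h4
            · exact hp j i k h3 h4 hk ⟨h1.symm, h2⟩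
            · exact (he j k i hlt h4 hi h1.symm).1 h2.symm
        intro i j k hi hj hk h1 h2
        have := key i j k hi hj hk h1 h2
        have := key i k j hi hk hj h2 h1
        omega
      obtain ⟨i0, k, h1, h2, h3, h4⟩ := hgap 1 (by omega) (by omega)
      have hi0 : i0 = 0 := by omega
      subst hi0
      by_cases hk : k = m - 1
      · subst hk
        by_cases hother : ∃ i j, 0 < i ∧ i < j ∧ j < m - 1 ∧ B.Adj i j
        · obtain ⟨i, j, hi, hij, hj, hE⟩ := hother
          have hm4 : m = 4 := by
            by_contra hne
            obtain ⟨w, hw0, hwm, hwi, hwj⟩ : ∃ w, 0 < w ∧ w < m - 1 ∧ w ≠ i ∧ w ≠ j := by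
              by_cases h1 : 1 ≠ i ∧ 1 ≠ j
              · exact ⟨1, by omega, by omega, h1⟩
              · by_cases h2 : 2 ≠ i ∧ 2 ≠ j
                · exact ⟨2, by omega, by omega, h2⟩
                · exact ⟨3, by omega, by omega, by omega, by omega⟩
            have hq : ∀ p q, 0 < p → p < q → q < m - 1 → B.Adj p q := by
              intro p q hp hpq hq
              have := hu 4 _ _ (by omega) (iv4 hi hij hj (by omega)) (iv4 hp hpq hq (by omega))
                (irr4a h4) (irr4a h4) 1 (by omega) 2 (by omega)
              exact this.1 hE
            have hiw : B.Adj i w := by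
              rcases lt_or_gt_of_ne hwi with h | h
              · exact (hq w i hw0 h (by omega)).symm
              · exact hq i w hi h hwm
            exact hwj (hmatch i w j (by omega) (by omega) (by omega) hiw hE)
          subst hm4
          right
          refine ⟨hm, rfl, Or.inr ?_⟩
          have e1 : i = 1 := by omega
          have e2 : j = 2 := by omega
          subst e1 e2
          have n1 := he 0 1 3 (by omega) (by omega) (by omega) h4
          have n2 := he 0 2 3 (by omega) (by omega) (by omega) h4
          refine ⟨RelEmbedding.refl _, ?_⟩
          have : (B.comap (fun i : Fin 4 => (i : ℕ))) = Qgraph2 :=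
            q2_eq B h4 hE n1.2 n2.2 n1.1 n2.1
          intro i j
          rw [this]; rfl
        · push Not at hother
          left; refine ⟨hm, Or.inr (Or.inl ?_)⟩
          apply graph_eq
          intro i j hij
          have hij' : (i : ℕ) < j := hij
          have hjm := j.2
          simp only [Jgraph2, SimpleGraph.fromRel_adj, SimpleGraph.comap_adj]
          constructor
          · intro h
            refine ⟨hij.ne, Or.inl ?_⟩
            by_cases hi : (i : ℕ) = 0
            · refine ⟨hi, ?_⟩
              rw [hi] at h
              exact hmatch 0 _ _ (by omega) hjm (by omega) h h4
            · by_cases hj : (j : ℕ) = m - 1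
              · exfalso
                rw [hj] at h
                have := hmatch (m - 1) _ _ (by omega) i.2 (by omega) h.symm h4.symm
                omega
              · exact absurd h (hother i j (by omega) hij' (by omega))
          · rintro ⟨-, h⟩
            have hi : (i : ℕ) = 0 := by omega
            have hj : (j : ℕ) = m - 1 := by omega
            rw [hi, hj]; exact h4
      · obtain ⟨i, l, h5, h6, h7, h8⟩ := hgap (k + 1) (by omega) (by omega)
        have hik : i ≠ k := by
          rintro rfl
          exact hp 0 i l (by omega) (by omega) h7 ⟨h4, h8⟩
        have hi0 : i ≠ 0 := by
          rintro rfl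
          have := hmatch 0 k l (by omega) h3 h7 h4 h8
          omega
        have hnl : ¬ B.Adj 0 l := by
          intro h
          have := hmatch 0 k l (by omega) h3 h7 h4 h
          omega
        have hshort : ∀ p q, q < m → B.Adj p q → q ≤ p + 2 := by
          intro p q hq h
          by_contra hlt
          have := hu 4 _ _ (by omega) (iv4 (show 0 < i by omega) (show i < k by omega)
            (show k < l by omega) h7)
            (iv4 (show p < p + 1 by omega) (show p + 1 < p + 2 by omega) (show p + 2 < q by omega) hq)
            (irr4b h4 h8) (irr4a h) 0 (by omega) 3 (by omega)
          exact hnl (this.2 h)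
        have := hshort 0 k h3 h4
        have := hshort i l h7 h8
        have e1 : k = 2 := by omega
        have e2 : i = 1 := by omega
        have e3 : l = 3 := by omega
        subst e1 e2 e3
        have hm4 : m = 4 := by
          by_contra hne
          obtain ⟨u, v, g1, g2, g3, g4⟩ := hgap 4 (by omega) (by omega)
          have := hshort u v g3 g4
          have : u = 2 ∨ u = 3 := by omega
          rcases this with rfl | rfl
          · exact hp 0 2 v (by omega) (by omega) g3 ⟨h4, g4⟩
          · exact hp 1 3 v (by omega) (by omega) g3 ⟨h8, g4⟩
        subst hm4
        right
        refine ⟨hm, rfl, Or.inl ?_⟩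
        have n1 := he 0 1 2 (by omega) (by omega) (by omega) h4
        have n2 := he 1 2 3 (by omega) (by omega) (by omega) h8
        refine ⟨RelEmbedding.refl _, ?_⟩
        have : (B.comap (fun i : Fin 4 => (i : ℕ))) = Qgraph1 :=
          q1_eq B h4 h8 n1.2 hnl n1.1 n2.1
        intro i j
        rw [this]; rfl

end OG

namespace OG

/-! ### Homogeneous blocks -/

lemma lHom_one {N : ℕ} (H : SimpleGraph (Fin N)) (x y : Fin N) :
    lHom H 1 x y ↔ ∀ v, v ≠ x → v ≠ y → (H.Adj x v ↔ H.Adj y v) := by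
  unfold lHom
  refine forall_congr' fun v => ?_
  have h : ∀ x : Fin N, (1 ≤ ((v : ℤ) - (x : ℤ)).natAbs) ↔ v ≠ x := by
    intro x
    rw [Ne, Fin.ext_iff]
    omega
  rw [h, h]

lemma lHom_one_trans {N : ℕ} (H : SimpleGraph (Fin N)) {x y z : Fin N}
    (h1 : lHom H 1 x y) (h2 : lHom H 1 y z) : lHom H 1 x z := by
  rw [lHom_one] at *
  intro v hx hz
  by_cases hv : v = y
  · subst hv
    by_cases hxz : x = z
    · rw [hxz]
    · have a := h1 z (Ne.symm hxz) (Ne.symm hz)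
      have b := h2 x (Ne.symm hx) hxz
      rw [H.adj_comm x v, b, H.adj_comm z v, H.adj_comm z x, a]
  · rw [h1 v hx hv, h2 v hv hz]

lemma homInterval_union {N : ℕ} (H : SimpleGraph (Fin N)) {B B' : Set (Fin N)} {b : Fin N}
    (hB : IsHomInterval H B) (hB' : IsHomInterval H B') (h1 : b ∈ B) (h2 : b ∈ B') :
    IsHomInterval H (B ∪ B') := by
  constructor
  · intro x y z hx hz hxy hyz
    rcases le_total y b with h | h
    · rcases hx with hx | hx
      · exact Or.inl (hB.1 x y b hx h1 hxy h)
      · exact Or.inr (hB'.1 x y b hx h2 hxy h)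
    · rcases hz with hz | hz
      · exact Or.inl (hB.1 b y z h1 hz h hyz)
      · exact Or.inr (hB'.1 b y z h2 hz h hyz)
  · intro x hx y hy
    have a : lHom H 1 x b := by
      rcases hx with hx | hx
      · exact hB.2 x hx b h1
      · exact hB'.2 x hx b h2
    have c : lHom H 1 b y := by
      rcases hy with hy | hy
      · exact hB.2 b h1 y hy
      · exact hB'.2 b h2 y hy
    exact lHom_one_trans H a c

lemma homBlocks_le {N : ℕ} (H : SimpleGraph (Fin N)) (f : Fin N → ℕ) (k : ℕ) (hf : Monotone f)
    (hk : ∀ x, f x < k) (hh : ∀ x y, f x = f y → lHom H 1 x y) : HomBlocksLE H k := by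
  classical
  unfold HomBlocksLE
  have hF : ∀ b, IsHomInterval H {x | f x = f b} := by
    intro b
    constructor
    · intro x y z hx hz hxy hyz
      have h1 := hf hxy
      have h2 := hf hyz
      change f x = f b at hx
      change f z = f b at hz
      change f y = f b
      omega
    · intro x hx y hy
      exact hh x y (Eq.trans hx (Eq.symm hy))
  let g : Set (Fin N) → ℕ := fun B => if h : B.Nonempty then f h.some else 0
  have hg : ∀ B ∈ {B | IsHomBlock H B}, g B ∈ Set.Iio k := by
    intro B hB
    have hB : IsHomBlock H B := hB
    simp only [g, hB.1, dite_true]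
    exact hk _
  have hinj : Set.InjOn g {B | IsHomBlock H B} := by
    intro B hB B' hB' hgg
    have hB : IsHomBlock H B := hB
    have hB' : IsHomBlock H B' := hB'
    simp only [g, hB.1, hB'.1, dite_true] at hgg
    set b := hB.1.some with hb
    set b' := hB'.1.some with hb'
    have m1 : b ∈ B := hB.1.some_mem
    have m2 : b' ∈ B' := hB'.1.some_mem
    have e1 := hB.2.2 _ Set.subset_union_left (homInterval_union H hB.2.1 (hF b) m1 rfl)
    have m3 : b' ∈ B := by rw [e1]; exact Or.inr hgg.symm
    have hu := homInterval_union H hB.2.1 hB'.2.1 m3 m2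
    have e2 := hB.2.2 _ Set.subset_union_left hu
    have e3 := hB'.2.2 _ Set.subset_union_right hu
    rw [e2, ← e3]
  have := Set.ncard_le_ncard_of_injOn g hg hinj (Set.finite_Iio k)
  simpa [Set.ncard_eq_toFinset_card'] using this

/-! ### Splitting along cuts -/

def rk (C : Finset ℕ) (x : ℕ) : ℕ := (C.filter (fun c => c ≤ x)).card

lemma rk_mono (C : Finset ℕ) : Monotone (rk C) := by
  intro x y h
  apply Finset.card_le_card
  intro c hc
  simp only [Finset.mem_filter] at *
  exact ⟨hc.1, hc.2.trans h⟩

lemma rk_le (C : Finset ℕ) (x : ℕ) : rk C x ≤ C.card := Finset.card_filter_le _ _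

lemma same_iff_rk (C : Finset ℕ) (x y : ℕ) : same C x y ↔ rk C x = rk C y := by
  constructor
  · intro h
    unfold rk
    congr 1
    apply Finset.filter_congr
    exact h
  · have key : ∀ x y, x ≤ y → rk C x = rk C y → same C x y := by
      intro x y hxy h
      have hsub : C.filter (fun c => c ≤ x) ⊆ C.filter (fun c => c ≤ y) := by
        intro c hc
        simp only [Finset.mem_filter] at *
        exact ⟨hc.1, hc.2.trans hxy⟩
      have he := Finset.eq_of_subset_of_card_le hsub (le_of_eq h.symm)
      intro c hc
      refine ⟨fun h => h.trans hxy, fun h => ?_⟩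
      have : c ∈ C.filter (fun c => c ≤ x) := by rw [he]; simp [hc, h]
      exact (Finset.mem_filter.1 this).2
    intro h
    rcases le_total x y with h1 | h1
    · exact key x y h1 h
    · exact (key y x h1 h.symm).symm

lemma init_seg (p : ℕ → Prop) (hp : ∀ x y, x ≤ y → p y → p x) (N : ℕ) :
    ∃ e, ∀ x, x < e ↔ x < N ∧ p x := by
  induction N with
  | zero => exact ⟨0, fun x => by simp⟩
  | succ N ih =>
    obtain ⟨e, he⟩ := ih
    by_cases h : p N
    · refine ⟨N + 1, fun x => ⟨fun hx => ⟨hx, hp x N (by omega) h⟩, fun hx => hx.1⟩⟩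
    · refine ⟨e, fun x => ?_⟩
      rw [he]
      refine ⟨fun hx => ⟨by omega, hx.2⟩, fun hx => ⟨?_, hx.2⟩⟩
      have : x ≠ N := by rintro rfl; exact h hx.2
      omega

lemma famsum (B : SimpleGraph ℕ) (N : ℕ) (C : Finset ℕ)
    (hB : ∀ u v, u < N → v < N → B.Adj u v → same C u v) :
    ∃ e : ℕ → ℕ, (∀ i, e i ≤ e (i + 1)) ∧ (∀ i, e i ≤ N) ∧
      (∀ i x y, e i ≤ x → x < e (i + 1) → y < N → (same C x y ↔ e i ≤ y ∧ y < e (i + 1))) ∧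
      IsFamSum (B.comap (fun i : Fin N => (i : ℕ))) (fun i : Fin (C.card + 1) => e (i + 1) - e i)
        (fun i => B.comap (fun x : Fin (e (i + 1) - e i) => e i + (x : ℕ))) := by
  have key : ∀ i, ∃ e, ∀ x, x < e ↔ x < N ∧ rk C x < i := fun i =>
    init_seg (fun x => rk C x < i) (fun x y hxy h => lt_of_le_of_lt (rk_mono C hxy) h) N
  choose e he using key
  have hmono : Monotone e := by
    intro i j hij
    by_contra hlt
    push Not at hlt
    have h1 := (he i (e j)).1 hlt
    have h2 := (he j (e j)).2 ⟨h1.1, by omega⟩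
    omega
  have hle : ∀ i, e i ≤ N := by
    intro i
    by_contra hlt
    push Not at hlt
    have h1 := (he i N).1 hlt
    omega
  have h0 : e 0 = 0 := by
    by_contra h
    have := (he 0 0).1 (by omega)
    omega
  have hN : e (C.card + 1) = N := by
    apply le_antisymm (hle _)
    by_contra hlt
    push Not at hlt
    have := (he (C.card + 1) (e (C.card + 1))).2 ⟨hlt, by have := rk_le C (e (C.card + 1)); omega⟩
    omega
  have hclass : ∀ i x, x < N → ((e i ≤ x ∧ x < e (i + 1)) ↔ rk C x = i) := by
    intro i x hx
    have h1 := he i x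
    have h2 := he (i + 1) x
    omega
  have htel : ∀ i, ∑ j ∈ Finset.range i, (e (j + 1) - e j) = e i := by
    intro i
    rw [Finset.sum_range_tsub hmono, h0]; simp
  have hsum : ∀ i : Fin (C.card + 1),
      (∑ j ∈ Finset.univ.filter (fun j : Fin (C.card + 1) => j < i), (e (j + 1) - e j)) = e i := by
    intro i
    rw [← htel i]
    apply Finset.sum_bij (fun (j : Fin (C.card + 1)) _ => (j : ℕ))
    · intro a ha
      simp only [Finset.mem_filter, Finset.mem_univ, true_and] at ha
      exact Finset.mem_range.2 ha
    · intro a _ b _ h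
      exact Fin.ext h
    · intro b hb
      have hb := Finset.mem_range.1 hb
      exact ⟨⟨b, by omega⟩, Finset.mem_filter.2 ⟨Finset.mem_univ _, hb⟩, rfl⟩
    · intro a _
      rfl
  refine ⟨e, fun i => hmono (Nat.le_succ i), hle, ?_, ?_, ?_⟩
  · intro i x y h1 h2 hy
    have hx : x < N := lt_of_lt_of_le h2 (hle _)
    rw [same_iff_rk, hclass i y hy, (hclass i x hx).1 ⟨h1, h2⟩]
    exact eq_comm
  · rw [Fin.sum_univ_eq_sum_range (fun j => e (j + 1) - e j), htel, hN]
  · intro u v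
    simp only [SimpleGraph.comap_adj]
    constructor
    · intro h
      have hs := hB u v u.2 v.2 h
      rw [same_iff_rk] at hs
      have hru := rk_le C u
      have a1 := (hclass (rk C u) u u.2).2 rfl
      have a2 := (hclass (rk C u) v v.2).2 hs.symm
      refine ⟨⟨rk C u, by omega⟩, ⟨u - e (rk C u), ?_⟩, ⟨v - e (rk C u), ?_⟩, ?_, ?_, ?_⟩
      · show (u : ℕ) - e (rk C u) < e (rk C u + 1) - e (rk C u); omega
      · show (v : ℕ) - e (rk C u) < e (rk C u + 1) - e (rk C u); omega
      · show B.Adj (e (rk C u) + (u - e (rk C u))) (e (rk C u) + (v - e (rk C u)))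
        rw [Nat.add_sub_cancel' a1.1, Nat.add_sub_cancel' a2.1]; exact h
      · rw [hsum]; exact (Nat.add_sub_cancel' a1.1).symm
      · rw [hsum]; exact (Nat.add_sub_cancel' a2.1).symm
    · rintro ⟨i, x, y, h, h1, h2⟩
      rw [hsum] at h1 h2
      rw [h1, h2]; exact h

/-! ### One block -/

lemma blockJA (B : SimpleGraph ℕ) (M ℓ : ℕ) (hb : ¬ Bad B ℓ 0 M) :
    InJA ℓ (B.comap (fun i : Fin M => (i : ℕ))) := by
  classical
  let C : Finset ℕ := (Finset.range M).filter
    (fun g => ∀ u v, u < g → g ≤ v → v < M → ¬ B.Adj u v)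
  have hC : ∀ g, g ∈ C ↔ g < M ∧ ∀ u v, u < g → g ≤ v → v < M → ¬ B.Adj u v := by
    intro g; simp [C]
  have hsame : ∀ u v, u < M → v < M → B.Adj u v → same C u v := by
    have key : ∀ u v, u < v → v < M → B.Adj u v → same C u v := by
      intro u v huv hv h g hg
      have := ((hC g).1 hg).2 u v
      constructor
      · intro h; omega
      · intro hgv
        by_contra hlt
        exact this (by omega) hgv hv h
    intro u v hu hv h
    rcases lt_or_gt_of_ne h.ne with h' | h'
    · exact key u v h' hv h
    · exact (key v u h' hu h.symm).symm
  obtain ⟨e, hmono, hle, hcl, hfam⟩ := famsum B M C hsame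
  have hirr : ∀ i, Irr B.Adj (e (i + 1) - e i) (fun x => e i + x) := by
    intro i g hg0 hgm
    have hlei := hle (i + 1)
    -- the point `e i + g` is not a cut
    have hs := (hcl i (e i) (e i + g) le_rfl (by omega) (by omega)).2 ⟨by omega, by omega⟩
    have hnc : e i + g ∉ C := by
      intro hc
      have := (hs _ hc).2 le_rfl
      omega
    rw [hC] at hnc
    push Not at hnc
    obtain ⟨u, v, h1, h2, h3, h4⟩ := hnc (by omega)
    have hsuv := hsame u v (by omega) h3 h4
    have hv : same C (e i) v := by
      have := (hsuv.btw (show u ≤ e i + g by omega) h2)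
      have h' := this.symm.trans hsuv
      exact hs.trans h'
    have b1 := (hcl i (e i) v le_rfl (by omega) h3).1 hv
    have b2 := (hcl i (e i) u le_rfl (by omega) (by omega)).1 (hv.trans hsuv.symm)
    refine ⟨u - e i, by omega, v - e i, by omega, by omega, ?_⟩
    show B.Adj (e i + (u - e i)) (e i + (v - e i))
    rw [Nat.add_sub_cancel' b1.1, Nat.add_sub_cancel' b2.1]
    exact h4
  unfold Bad at hb
  push Not at hb
  obtain ⟨hb1, hb2⟩ := hb
  have hsz : ∀ i, e (i + 1) - e i ≤ ℓ := by
    intro i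
    by_contra hlt
    obtain ⟨φ, h1, h2, h3⟩ := irr_sub B.Adj _ (ℓ + 1) (by omega) (by omega) _ (hirr i)
    have hlei := hle (i + 1)
    refine hb1 _ ⟨?_, ?_⟩ h3
    · intro p q hpq hq
      have := h1 hpq
      show e i + φ p < e i + φ q
      omega
    · intro p hp
      have := h2 p hp
      show 0 ≤ e i + φ p ∧ e i + φ p < M
      omega
  have hpat : ∀ r S S', 1 ≤ r → r ≤ ℓ → InIv 0 M r S → InIv 0 M r S' → Irr B.Adj r S →
      Irr B.Adj r S' → ∀ p < r, ∀ q < r, (B.Adj (S p) (S q) ↔ B.Adj (S' p) (S' q)) := by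
    intro r S S' h1 h2 h3 h4 h5 h6 p hp q hq
    by_contra hne
    have := hb2 r h2 h1 S S' h3 h4 h5 h6 p hp q hq
    tauto
  refine ⟨C.card + 1, _, _, hfam, ?_, ?_⟩
  · intro j
    have hlei := hle (j + 1)
    have := classify (B.comap (fun x => e j + x)) (e (j + 1) - e j) ℓ (hsz j) ?_ ?_
    · exact this
    · exact hirr j
    · intro r S S' h1 h3 h4 h5 h6 p hp q hq
      have hr : r ≤ e (j + 1) - e j := by
        have aux : ∀ p, p < r → p ≤ S p := by
          intro p
          induction p with
          | zero => intro _; omega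
          | succ p ih =>
            intro hp
            have := h3.1 p (p + 1) (by omega) hp
            have := ih (by omega)
            omega
        have := aux (r - 1) (by omega)
        have := h3.2 (r - 1) (by omega)
        omega
      have tr : ∀ S, InIv 0 (e (j + 1) - e j) r S → InIv 0 M r (fun x => e j + S x) := by
        intro S h
        refine ⟨fun p q hpq hq => ?_, fun p hp => ?_⟩
        · have := h.1 p q hpq hq
          show e j + S p < e j + S q
          omega
        · have := h.2 p hp
          show 0 ≤ e j + S p ∧ e j + S p < M
          omega
      exact hpat r _ _ h1 (hr.trans (hsz j)) (tr S h3) (tr S' h4) h5 h6 p hp q hq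
  · have key : ∀ i j, e (i + 1) - e i ≤ e (j + 1) - e j →
        IndSub (B.comap (fun x : Fin (e (i + 1) - e i) => e i + (x : ℕ)))
          (B.comap (fun x : Fin (e (j + 1) - e j) => e j + (x : ℕ))) := by
      intro i j hij
      rcases Nat.eq_zero_or_pos (e (i + 1) - e i) with h0 | hpos
      · have : IsEmpty (Fin (e (i + 1) - e i)) := by rw [h0]; infer_instance
        exact ⟨⟨⟨isEmptyElim, fun x => isEmptyElim x⟩, fun {x} => isEmptyElim x⟩,
          fun x => isEmptyElim x⟩
      · obtain ⟨φ, h1, h2, h3⟩ := irr_sub B.Adj _ _ hpos hij _ (hirr j)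
        have hlei := hle (i + 1)
        have hlej := hle (j + 1)
        have hp := hpat _ (fun x => e i + x) (fun x => e j + φ x) hpos (hsz i)
          ⟨fun p q hpq _ => by
            show e i + p < e i + q
            omega, fun p hp => by
            show 0 ≤ e i + p ∧ e i + p < M
            omega⟩
          ⟨fun p q hpq _ => by
            have := h1 hpq
            show e j + φ p < e j + φ q
            omega, fun p hp => by
            have := h2 p hp
            show 0 ≤ e j + φ p ∧ e j + φ p < M
            omega⟩ (hirr i) h3
        refine ⟨OrderEmbedding.ofStrictMono (fun x => ⟨φ x, h2 x x.2⟩) ?_, ?_⟩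
        · intro x y hxy
          exact h1 hxy
        · intro x y
          exact hp x x.2 y y.2
    intro j j'
    rcases le_total (e (j + 1) - e j) (e (j' + 1) - e j') with h | h
    · exact Or.inl (key j j' h)
    · exact Or.inr (key j' j h)

end OG

namespace OG

lemma bad_shift (B B' : SimpleGraph ℕ) (ℓ a M : ℕ)
    (hBB : ∀ x y, x < M → y < M → (B.Adj x y ↔ B'.Adj (a + x) (a + y))) (h : Bad B ℓ 0 M) :
    Bad B' ℓ a (a + M) := by
  have tr : ∀ r S, InIv 0 M r S → InIv a (a + M) r (fun x => a + S x) := by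
    intro r S h
    refine ⟨fun p q hpq hq => ?_, fun p hp => ?_⟩
    · have := h.1 p q hpq hq
      show a + S p < a + S q
      omega
    · have := h.2 p hp
      show a ≤ a + S p ∧ a + S p < a + M
      omega
  have ti : ∀ r S, InIv 0 M r S → Irr B.Adj r S → Irr B'.Adj r (fun x => a + S x) := by
    intro r S h hi g hg hgr
    obtain ⟨i, h1, j, h2, h3, h4⟩ := hi g hg hgr
    exact ⟨i, h1, j, h2, h3, (hBB _ _ (h.2 i (by omega)).2 (h.2 j h3).2).1 h4⟩
  rcases h with ⟨S, h1, h2⟩ | ⟨r, hr, hr1, S, S', h1, h2, h3, h4, p, hp, q, hq, hne⟩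
  · exact Or.inl ⟨_, tr _ S h1, ti _ S h1 h2⟩
  · refine Or.inr ⟨r, hr, hr1, _, _, tr _ S h1, tr _ S' h2, ti _ S h1 h3, ti _ S' h2 h4,
      p, hp, q, hq, ?_⟩
    rw [← hBB _ _ (h1.2 p hp).2 (h1.2 q hq).2, ← hBB _ _ (h2.2 p hp).2 (h2.2 q hq).2]
    exact hne

lemma not_bad_zero (B : SimpleGraph ℕ) (ℓ a : ℕ) : ¬ Bad B ℓ a a := by
  rintro (⟨S, h1, -⟩ | ⟨r, -, hr1, S, -, h1, -⟩)
  · have := h1.2 0 (by omega); omega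
  · have := h1.2 0 (by omega); omega

/-- The cut part `J`. -/
def Jg (A : SimpleGraph ℕ) (C : Finset ℕ) (c : ℕ → Prop)
    (hc : ∀ x y, same C x y → (c x ↔ c y)) : SimpleGraph ℕ where
  Adj u v := u ≠ v ∧ same C u v ∧ ¬ (A.Adj u v ↔ c u)
  symm := ⟨by
    rintro u v ⟨h1, h2, h3⟩
    refine ⟨h1.symm, h2.symm, ?_⟩
    rw [A.adj_comm, ← hc u v h2]; exact h3⟩
  loopless := ⟨fun u h => h.1 rfl⟩

/-- The homogeneous part `H`. -/
def Hg (A : SimpleGraph ℕ) (C : Finset ℕ) (c : ℕ → Prop)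
    (hc : ∀ x y, same C x y → (c x ↔ c y)) : SimpleGraph ℕ where
  Adj u v := u ≠ v ∧ ((same C u v ∧ c u) ∨ (¬ same C u v ∧ A.Adj u v))
  symm := ⟨by
    rintro u v ⟨h1, ⟨h2, h3⟩ | ⟨h2, h3⟩⟩
    · exact ⟨h1.symm, Or.inl ⟨h2.symm, (hc u v h2).1 h3⟩⟩
    · exact ⟨h1.symm, Or.inr ⟨fun h => h2 h.symm, h3.symm⟩⟩⟩
  loopless := ⟨fun u h => h.1 rfl⟩

/-- The set of cuts, thickened by `ℓ`. -/
def thick (C : Finset ℕ) (ℓ : ℕ) : Finset ℕ :=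
  (C ×ˢ Finset.range (ℓ + 1)).image (fun p => p.1 + p.2) ∪
    (C ×ˢ Finset.range (ℓ + 1)).image (fun p => p.1 - p.2)

lemma thick_card (C : Finset ℕ) (ℓ : ℕ) : (thick C ℓ).card ≤ 2 * (C.card * (ℓ + 1)) := by
  refine (Finset.card_union_le _ _).trans ?_
  have h1 := Finset.card_image_le (s := C ×ˢ Finset.range (ℓ + 1)) (f := fun p => p.1 + p.2)
  have h2 := Finset.card_image_le (s := C ×ˢ Finset.range (ℓ + 1)) (f := fun p => p.1 - p.2)
  rw [Finset.card_product, Finset.card_range] at h1 h2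
  omega

lemma thick_add {C : Finset ℕ} {ℓ c d : ℕ} (hc : c ∈ C) (hd : d ≤ ℓ) : c + d ∈ thick C ℓ :=
  Finset.mem_union_left _ (Finset.mem_image.2 ⟨(c, d), by simp [hc]; omega, rfl⟩)

lemma thick_sub {C : Finset ℕ} {ℓ c d : ℕ} (hc : c ∈ C) (hd : d ≤ ℓ) : c - d ∈ thick C ℓ :=
  Finset.mem_union_right _ (Finset.mem_image.2 ⟨(c, d), by simp [hc]; omega, rfl⟩)

lemma not_same_lt {C : Finset ℕ} {x y : ℕ} (hxy : x < y) (h : ¬ same C x y) :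
    ∃ c ∈ C, x < c ∧ c ≤ y := by
  unfold same at h
  push Not at h
  obtain ⟨c, hc, h⟩ := h
  exact ⟨c, hc, by omega, by omega⟩

lemma Hg_hom (A : SimpleGraph ℕ) (C : Finset ℕ) (c : ℕ → Prop) (N ℓ : ℕ)
    (hc : ∀ x y, same C x y → (c x ↔ c y))
    (hfar : ∀ x v x' v', same C x x' → same C v v' → x + ℓ ≤ v → x' + ℓ ≤ v' → v < N → v' < N →
      (A.Adj x v ↔ A.Adj x' v'))
    (x y v : ℕ) (hxy : x < y) (hy : y < N) (hv : v < N) (hvx : v ≠ x) (hvy : v ≠ y)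
    (hs : same (thick C ℓ) x y) : (Hg A C c hc).Adj x v ↔ (Hg A C c hc).Adj y v := by
  have hs' : same C x y := hs.mono (fun c hc => thick_add hc (Nat.zero_le ℓ))
  show (x ≠ v ∧ _) ↔ (y ≠ v ∧ _)
  by_cases hxv : same C x v
  · have hyv : same C y v := hs'.symm.trans hxv
    have := hc x y hs'
    have := hvx.symm
    have := hvy.symm
    tauto
  · have hyv : ¬ same C y v := fun h => hxv (hs'.trans h)
    have hA : A.Adj x v ↔ A.Adj y v := by
      rcases lt_or_gt_of_ne hvx with h | h
      · by_cases hf : v + ℓ ≤ x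
        · rw [A.adj_comm x v, A.adj_comm y v]
          exact hfar v x v y (same.refl _ _) hs' hf (by omega) (by omega) hy
        · exfalso
          obtain ⟨d, hd, h1, h2⟩ := not_same_lt h (fun h => hxv h.symm)
          have hm := thick_add (ℓ := ℓ) (d := x + 1 - d) hd (by omega)
          have := (hs _ hm).2 (by omega)
          omega
      · rcases lt_or_gt_of_ne hvy with h' | h'
        · exact absurd (hs'.btw h.le h'.le) hxv
        · by_cases hf : y + ℓ ≤ v
          · exact hfar x v y v hs' (same.refl _ _) (by omega) hf hv hv
          · exfalso
            obtain ⟨d, hd, h1, h2⟩ := not_same_lt h' hyv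
            have hm := thick_sub (ℓ := ℓ) (d := d - y) hd (by omega)
            have := (hs _ hm).2 (by omega)
            omega
    have := hvx.symm
    have := hvy.symm
    tauto

theorem main (P : HerProp) (n ℓ : ℕ) (hn : 1 ≤ n) (hℓ : 1 ≤ ℓ)
    (h : speed P n < genFib (ℓ + 1) n) :
    ∃ k k' : ℕ, ∀ (N : ℕ) (G : SimpleGraph (Fin N)), G ∈ P.mem N →
      ∃ H J : SimpleGraph (Fin N), HomBlocksLE H k ∧ InJkl k' ℓ J ∧
        ∀ u v : Fin N, G.Adj u v ↔
          ((H.Adj u v ∧ ¬ J.Adj u v) ∨ (J.Adj u v ∧ ¬ H.Adj u v)) := by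
  obtain ⟨K, hK⟩ := structure_cuts (P := P) (n := n) (ℓ := ℓ) ⟨hn, hℓ, h⟩
  refine ⟨2 * (K * (ℓ + 1)) + 1, K + 1, fun N G hG => ?_⟩
  set A : SimpleGraph ℕ := G.map Fin.valEmbedding with hA
  have hAG : A.comap (fun i : Fin N => (i : ℕ)) = G := SimpleGraph.comap_map_eq Fin.valEmbedding G
  obtain ⟨C, c, hCK, hc, hfar, -, hbad⟩ := hK N A (by rw [hAG]; exact hG)
  refine ⟨(Hg A C c hc).comap (fun i : Fin N => (i : ℕ)),
    (Jg A C c hc).comap (fun i : Fin N => (i : ℕ)), ?_, ?_, ?_⟩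
  · apply homBlocks_le _ (fun x => rk (thick C ℓ) x)
    · intro x y hxy
      exact rk_mono _ hxy
    · intro x
      have h1 := rk_le (thick C ℓ) x
      have h2 := thick_card C ℓ
      have h3 := Nat.mul_le_mul_right (ℓ + 1) hCK
      show rk (thick C ℓ) x < _
      omega
    · intro x y hxy
      have hs := (same_iff_rk (thick C ℓ) x y).2 hxy
      rw [lHom_one]
      intro v hx hy
      have hx' : (v : ℕ) ≠ x := fun h => hx (Fin.ext h)
      have hy' : (v : ℕ) ≠ y := fun h => hy (Fin.ext h)
      simp only [SimpleGraph.comap_adj]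
      rcases lt_trichotomy (x : ℕ) y with h' | h' | h'
      · exact Hg_hom A C c N ℓ hc hfar x y v h' y.2 v.2 hx' hy' hs
      · rw [h']
      · exact (Hg_hom A C c N ℓ hc hfar y x v h' x.2 v.2 hy' hx' hs.symm).symm
  · obtain ⟨e, hmono, hle, hcl, hfam⟩ := famsum (Jg A C c hc) N C (fun u v _ _ h => h.2.1)
    refine ⟨C.card + 1, _, _, by omega, hfam, ?_⟩
    intro i
    have hm := hmono i
    have hl := hle (i + 1)
    have := blockJA ((Jg A C c hc).comap (fun x => e i + x)) (e (i + 1) - e i) ℓ ?_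
    · exact this
    · intro hB
      rcases Nat.eq_zero_or_pos (e (i + 1) - e i) with h0 | hpos
      · rw [h0] at hB
        exact not_bad_zero _ _ _ hB
      · have hcls : ∀ x, x < e (i + 1) - e i → same C (e i) (e i + x) := fun x hx =>
          (hcl i (e i) (e i + x) le_rfl (by omega) (by omega)).2 ⟨by omega, by omega⟩
        have hB' := bad_shift _ (Jc A (c (e i))) ℓ (e i) (e (i + 1) - e i) ?_ hB
        · refine hbad (e i) (e (i + 1) - 1) (by omega) (by omega) ?_ ?_
          · have := hcls (e (i + 1) - e i - 1) (by omega)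
            rwa [show e i + (e (i + 1) - e i - 1) = e (i + 1) - 1 by omega] at this
          · rwa [show e i + (e (i + 1) - e i) = e (i + 1) - 1 + 1 by omega] at hB'
        · intro x y hx hy
          rw [Jc_adj]
          have s1 := hcls x hx
          have s2 := hcls y hy
          have s3 := s1.symm.trans s2
          have s4 := hc _ _ s1
          show (e i + x ≠ e i + y ∧ _ ∧ _) ↔ _
          tauto
  · intro u v
    have hGA : G.Adj u v ↔ A.Adj u v := by rw [← hAG]; rfl
    rw [hGA]
    show _ ↔ (((u : ℕ) ≠ v ∧ _) ∧ ¬ ((u : ℕ) ≠ v ∧ _ ∧ _)) ∨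
      (((u : ℕ) ≠ v ∧ _ ∧ _) ∧ ¬ ((u : ℕ) ≠ v ∧ _))
    have hne : A.Adj u v → (u : ℕ) ≠ v := fun h => h.ne
    by_cases h1 : (u : ℕ) = v
    · tauto
    · by_cases h2 : same C u v <;> by_cases h3 : c u <;> by_cases h4 : A.Adj u v <;>
        simp [h1, h2, h3, h4]

end OG

/-- **Theorem (structure of a property with speed `p(n)F_{n,ℓ}`).**  If
`|P_n| < F_{n,ℓ+1}` then there exist `k, k'` such that every `G ∈ P` is of the form
`G = H △ J` with `H` having at most `k` homogeneous blocks and `J ∈ 𝒥(k',ℓ)`. -/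
theorem fibonacci_structure (P : HerProp) (n ℓ : ℕ) (hn : 1 ≤ n) (hℓ : 1 ≤ ℓ)
    (h : speed P n < genFib (ℓ + 1) n) :
    ∃ k k' : ℕ, ∀ (N : ℕ) (G : SimpleGraph (Fin N)), G ∈ P.mem N →
      ∃ H J : SimpleGraph (Fin N), HomBlocksLE H k ∧ InJkl k' ℓ J ∧
        ∀ u v : Fin N, G.Adj u v ↔
          ((H.Adj u v ∧ ¬ J.Adj u v) ∨ (J.Adj u v ∧ ¬ H.Adj u v)) := by
  exact OG.main P n ℓ hn hℓ h
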